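/- arXiv:2507.10937 — 13 statements merged into one kernel-verified Lean document; each statement's English description precedes it below -/
import Mathlib

section
/- Let A and B be nonempty finite subsets of an abelian group G such that |A| = |B| and 1 ∉ B. Then there exists a matching from A to B if and only if for every pair of nonempty subsets S ⊆ A and R ⊆ B ∪ {1} such that SR = S, we have |S| ≤ |B \ R|. -/
open Pointwise

/-- Repeated Dyson transforms turn a pair `(S, R)` with `1 ∈ R` into a pair with `S * R = S`,
keeping `#S + #R`, without enlarging `R`, and with the new `S` inside the old `S * R`. -/
theorem exists_mul_eq_self_of_mul_subset {G : Type*} [CommGroup G] [DecidableEq G]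
    {A S R : Finset G} (hS : S.Nonempty) (hR : 1 ∈ R) (hSR : S * R ⊆ A) :
    ∃ S' R' : Finset G, S'.Nonempty ∧ 1 ∈ R' ∧ S' ⊆ A ∧ R' ⊆ R ∧ S' * R' = S' ∧
      S'.card + R'.card = S.card + R.card := by
  induction hn : R.card using Nat.strong_induction_on generalizing S R with
  | _ n ih =>
  subst hn
  have hSA : S ⊆ S * R := Finset.subset_mul_left S hR
  by_cases h : S * R ⊆ S
  · exact ⟨S, R, hS, hR, hSA.trans hSR, subset_rfl, h.antisymm hSA, rfl⟩
  obtain ⟨e, he, r, hr, her⟩ : ∃ e ∈ S, ∃ r ∈ R, e * r ∉ S := by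
    simpa [Finset.mul_subset_iff] using h
  let x := Finset.mulDysonETransform e (S, R)
  have hcard : x.1.card + x.2.card = S.card + R.card :=
    Finset.mulDysonETransform.card e (S, R)
  have hsub : x.1 * x.2 ⊆ S * R := Finset.mulDysonETransform.subset e (S, R)
  have hx2 : x.2 ⊆ R := Finset.inter_subset_left
  have hone : 1 ∈ x.2 :=
    Finset.mem_inter.2 ⟨hR, Finset.mem_smul_finset.2 ⟨e, he, by simp⟩⟩
  have hr' : r ∉ x.2 := fun hmem => by
    obtain ⟨s, hs, rfl⟩ := Finset.mem_smul_finset.1 (Finset.mem_inter.1 hmem).2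
    exact her (by simpa using hs)
  have hlt : x.2.card < R.card :=
    Finset.card_lt_card (Finset.ssubset_iff_subset_ne.2 ⟨hx2, fun h' => hr' (h' ▸ hr)⟩)
  obtain ⟨S', R', h₁, h₂, h₃, h₄, h₅, h₆⟩ :=
    ih _ hlt (hS.mono Finset.subset_union_left) hone (hsub.trans hSR) rfl
  exact ⟨S', R', h₁, h₂, h₃, h₄.trans hx2, h₅, h₆.trans hcard⟩

/-- Hall's marriage theorem for matchings between finite sets of equal size. -/
theorem exists_matching_of_hall {G : Type*} [Mul G] [DecidableEq G]
    {A B : Finset G} (hcard : A.card = B.card)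
    (hall : ∀ S ⊆ A, S.card ≤ (B.filter fun b => ∃ a ∈ S, a * b ∉ A).card) :
    ∃ f : G → G, Set.BijOn f ↑A ↑B ∧ ∀ a ∈ A, a * f a ∉ A := by
  obtain ⟨f, hf, hfB⟩ := (Finset.all_card_le_biUnion_card_iff_exists_injective
    fun a : A => B.filter fun b => (a : G) * b ∉ A).1 fun s => by
      have h := hall (s.map (Function.Embedding.subtype _)) (Finset.map_subtype_subset s)
      rw [Finset.card_map] at h
      refine h.trans (Finset.card_le_card fun b hb => ?_)
      simpa [and_left_comm] using hb
  simp only [Finset.mem_filter] at hfB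
  let g : G → G := fun a => if h : a ∈ A then f ⟨a, h⟩ else a
  have hg (a) (h : a ∈ A) : g a = f ⟨a, h⟩ := dif_pos h
  have hmaps : Set.MapsTo g A B := fun a ha => by
    rw [hg a ha]
    exact (hfB _).1
  have hinj : Set.InjOn g A := fun a ha b hb hab => by
    rw [hg a ha, hg b hb] at hab
    exact congrArg Subtype.val (hf hab)
  refine ⟨g, ⟨hmaps, hinj, Finset.surjOn_of_injOn_of_card_le g hmaps hinj hcard.ge⟩,
    fun a ha => ?_⟩
  rw [hg a ha]
  exact (hfB ⟨a, ha⟩).2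

/-- Theorem: matchability in abelian groups characterized via Dyson transforms.
A matching from `A` to `B` is a bijection `f : A → B` with `a * f a ∉ A` for all `a ∈ A`. -/
theorem stmt_1 {G : Type*} [CommGroup G] [DecidableEq G]
    (A B : Finset G) (hA : A.Nonempty) (hB : B.Nonempty) (hcard : A.card = B.card)
    (h1 : (1 : G) ∉ B) :
    (∃ f : G → G, Set.BijOn f ↑A ↑B ∧ ∀ a ∈ A, a * f a ∉ A) ↔
      ∀ S R : Finset G, S.Nonempty → R.Nonempty → S ⊆ A → R ⊆ B ∪ {1} →
        S * R = S → S.card ≤ (B \ R).card := by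
  constructor
  · rintro ⟨f, hf, hfA⟩ S R - - hSA - hSR
    refine Finset.card_le_card_of_injOn f (fun a ha => ?_) (hf.injOn.mono hSA)
    refine Finset.mem_sdiff.2 ⟨hf.mapsTo (hSA ha), fun hR => hfA a (hSA ha) (hSA ?_)⟩
    exact hSR ▸ Finset.mul_mem_mul ha hR
  · refine fun h => exists_matching_of_hall hcard fun S hSA => ?_
    obtain rfl | hS := S.eq_empty_or_nonempty
    · simp
    let U := B.filter fun b => ¬ ∃ a ∈ S, a * b ∉ A
    have hU1 : 1 ∉ U := fun hU => h1 (Finset.mem_filter.1 hU).1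
    have hsub : S * insert 1 U ⊆ A := Finset.mul_subset_iff.2 fun a ha b hb => by
      obtain rfl | hb := Finset.mem_insert.1 hb
      · simpa using hSA ha
      · by_contra hab
        exact (Finset.mem_filter.1 hb).2 ⟨a, ha, hab⟩
    obtain ⟨S', R', hS', hR', hS'A, hR'U, hmul, hsum⟩ :=
      exists_mul_eq_self_of_mul_subset hS (Finset.mem_insert_self 1 U) hsub
    have hR'B : R' ⊆ insert 1 B :=
      hR'U.trans (Finset.insert_subset_insert 1 (Finset.filter_subset _ _))
    have hle := h S' R' hS' ⟨1, hR'⟩ hS'A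
      (by rwa [Finset.union_comm, ← Finset.insert_eq]) hmul
    rw [← Finset.insert_sdiff_of_mem B hR', Finset.card_sdiff_of_subset hR'B,
      Finset.card_insert_of_notMem h1] at hle
    have hR'card := Finset.card_le_card hR'B
    rw [Finset.card_insert_of_notMem h1] at hR'card
    rw [Finset.card_insert_of_notMem hU1] at hsum
    have hsplit := Finset.card_filter_add_card_filter_not (s := B) fun b => ∃ a ∈ S, a * b ∉ A
    change _ + U.card = _ at hsplit
    omega
end

section
/- Let A and B be nonempty finite subsets of an abelian group G such that |A| = |B| and 1 ∉ B, and let n be a positive integer. Assume that A contains no progression of length greater than n, and that every element of B has order greater than n. Then there exists a matching from A to B. -/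
open Finset in
/-- If `1 ∈ U` and `S * U ⊆ A` with `|A| + 1 < |S| + |U|`, then `A` contains a full coset of the
cyclic group generated by some nontrivial element of `U`. The proof replaces `S` and `U` by their
Dyson transforms `S ∪ e • U` and `U ∩ e⁻¹ • S` until `U` stabilizes `S`. -/
theorem exists_forall_mul_pow_mem_of_card_lt {G : Type*} [CommGroup G] (A S U : Finset G)
    (hS : S.Nonempty) (h1 : (1 : G) ∈ U) (hSU : ∀ s ∈ S, ∀ u ∈ U, s * u ∈ A)
    (hcard : #A + 1 < #S + #U) :
    ∃ x ∈ U, x ≠ 1 ∧ ∃ a, ∀ i : ℕ, a * x ^ i ∈ A := by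
  classical
  induction U using Finset.strongInduction generalizing S with
  | H U ih =>
    by_cases hstab : ∀ s ∈ S, ∀ u ∈ U, s * u ∈ S
    · obtain ⟨a, ha⟩ := hS
      have hSA : #S ≤ #A := card_le_card fun s hs ↦ by simpa using hSU s hs 1 h1
      obtain ⟨x, hx, hx1⟩ := exists_mem_ne (show 1 < #U by omega) 1
      have hpow (i : ℕ) : a * x ^ i ∈ S := by
        induction i with
        | zero => simpa
        | succ i hi => simpa [pow_succ, mul_assoc] using hstab _ hi x hx
      exact ⟨x, hx, hx1, a, fun i ↦ by simpa using hSU _ (hpow i) 1 h1⟩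
    · push Not at hstab
      obtain ⟨e, he, v, hv, hev⟩ := hstab
      have hinj : Function.Injective (e * ·) := mul_right_injective e
      have hinter : #(U.filter (e * · ∈ S)) = #(S ∩ U.image (e * ·)) := by
        rw [← card_image_of_injective _ hinj]
        congr 1
        ext g
        simp only [mem_image, mem_filter, mem_inter]
        grind
      have hsum := card_union_add_card_inter S (U.image (e * ·))
      rw [card_image_of_injective _ hinj] at hsum
      obtain ⟨x, hx, hx1, a, ha⟩ := ih (U.filter (e * · ∈ S))
        (filter_ssubset.2 ⟨v, hv, hev⟩) (S ∪ U.image (e * ·)) (hS.mono subset_union_left)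
        (by simp [h1, he]) (by
          intro s hs u hu
          obtain ⟨huU, hue⟩ := mem_filter.1 hu
          rcases mem_union.1 hs with hs | hs
          · exact hSU s hs u huU
          · obtain ⟨w, hw, rfl⟩ := mem_image.1 hs
            rw [mul_right_comm]
            exact hSU _ hue w hw)
        (by omega)
      exact ⟨x, (mem_filter.1 hx).1, hx1, a, ha⟩


/-- If `A` contains no progression of length greater than `n` (a progression of length `m`
being a set `{a, a*x, …, a*x^(m-1)}` with `m - 1 < orderOf x`, where an element of infinite
order has `orderOf x = 0`), and every element of `B` has order greater than `n`, then there
is a matching from `A` to `B`. -/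
theorem stmt_3 {G : Type*} [CommGroup G]
    (A B : Finset G) (hA : A.Nonempty) (hB : B.Nonempty) (hcard : A.card = B.card)
    (h1 : (1 : G) ∉ B) (n : ℕ) (hn : 0 < n)
    (hprog : ∀ (a x : G) (m : ℕ), n < m → (orderOf x = 0 ∨ m - 1 < orderOf x) →
      ¬ (∀ i < m, a * x ^ i ∈ A))
    (hord : ∀ b ∈ B, orderOf b = 0 ∨ n < orderOf b) :
    ∃ f : G → G, Set.BijOn f ↑A ↑B ∧ ∀ a ∈ A, a * f a ∉ A := by
  classical
  have hall : ∀ S : Finset {a // a ∈ A},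
      S.card ≤ (S.biUnion fun a ↦ B.filter fun b ↦ a.1 * b ∉ A).card := by
    intro S
    rcases S.eq_empty_or_nonempty with rfl | hS
    · simp
    by_contra! hlt
    let U := B.filter fun b ↦ ∀ a ∈ S, a.1 * b ∈ A
    have hBU : B.card ≤ (S.biUnion fun a ↦ B.filter fun b ↦ a.1 * b ∉ A).card + U.card := by
      refine (Finset.card_le_card fun b hb ↦ ?_).trans (Finset.card_union_le _ _)
      simp only [U, Finset.mem_union, Finset.mem_biUnion, Finset.mem_filter]
      grind
    have h1U : (1 : G) ∉ U := fun h ↦ h1 (Finset.mem_filter.1 h).1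
    obtain ⟨x, hx, hx1, a, ha⟩ := exists_forall_mul_pow_mem_of_card_lt A
      (S.map (Function.Embedding.subtype _)) (insert 1 U) (hS.map) (Finset.mem_insert_self _ _)
      (by
        intro s hs u hu
        obtain ⟨s, hsS, rfl⟩ := Finset.mem_map.1 hs
        rcases Finset.mem_insert.1 hu with rfl | hu
        · simp
        · exact (Finset.mem_filter.1 hu).2 s hsS)
      (by rw [Finset.card_map, Finset.card_insert_of_notMem h1U]; omega)
    have hxB : x ∈ B := (Finset.mem_filter.1 ((Finset.mem_insert.1 hx).resolve_left hx1)).1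
    exact hprog a x (n + 1) n.lt_succ_self (hord x hxB) fun i _ ↦ ha i
  obtain ⟨f, hf, hft⟩ := (Finset.all_card_le_biUnion_card_iff_exists_injective _).1 hall
  simp only [Finset.mem_filter] at hft
  let g : G → G := fun a ↦ if h : a ∈ A then f ⟨a, h⟩ else 1
  have hg (a : G) (h : a ∈ A) : g a = f ⟨a, h⟩ := dif_pos h
  have hmaps : Set.MapsTo g A B := fun a ha ↦ by
    rw [hg a ha]
    exact (hft ⟨a, ha⟩).1
  have hinj : Set.InjOn g A := fun a ha b hb hab ↦ by
    rw [hg a ha, hg b hb] at hab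
    exact congrArg Subtype.val (hf hab)
  refine ⟨g, ⟨hmaps, hinj, Finset.surjOn_of_injOn_of_card_le g hmaps hinj hcard.ge⟩,
    fun a ha ↦ ?_⟩
  rw [hg a ha]
  exact (hft ⟨a, ha⟩).2
end

section
/- Let A and B be nonempty finite subsets of an abelian group G such that |A| = |B| and 1 ∉ B. If B is a Chowla subset of G, then there exists a matching from A to B. -/
/-- A finite set stable under multiplication by `u` is empty if it has fewer than `orderOf u`
elements. -/
theorem Finset.eq_empty_of_mul_mem_of_card_lt_orderOf {G : Type*} [CommGroup G]
    {S : Finset G} {u : G} (hu : orderOf u = 0 ∨ S.card < orderOf u)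
    (hS : ∀ x ∈ S, x * u ∈ S) : S = ∅ := by
  by_contra hne
  obtain ⟨x, hx⟩ := Finset.nonempty_iff_ne_empty.2 hne
  have hpow : ∀ k : ℕ, x * u ^ k ∈ S := by
    intro k
    induction k with
    | zero => simpa using hx
    | succ k ih => rw [pow_succ, ← mul_assoc]; exact hS _ ih
  have hle : (Finset.range (S.card + 1)).card ≤ S.card := by
    refine Finset.card_le_card_of_injOn (fun k => x * u ^ k) (fun k _ => hpow k) ?_
    intro i hi j hj hij
    have hmod := pow_eq_pow_iff_modEq.1 (mul_left_cancel hij)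
    simp only [Finset.coe_range, Set.mem_Iio] at hi hj
    rcases hu with h0 | hlt
    · rw [h0] at hmod
      exact Nat.modEq_zero_iff.1 hmod
    · exact Nat.ModEq.eq_of_lt_of_lt hmod (by omega) (by omega)
  rw [Finset.card_range] at hle
  omega

open scoped Pointwise in
/-- A Chowla-type bound: if `1 ∈ T` and every other element of `T` has order greater than
`n ≥ |S * T|`, then `|S| + |T| ≤ |S * T| + 1`. -/
theorem Finset.card_add_card_le_card_mul_add_one {G : Type*} [CommGroup G] [DecidableEq G]
    {n : ℕ} {S T : Finset G} (hS : S.Nonempty) (h1 : (1 : G) ∈ T)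
    (hT : ∀ u ∈ T, u ≠ 1 → orderOf u = 0 ∨ n < orderOf u) (hn : (S * T).card ≤ n) :
    S.card + T.card ≤ (S * T).card + 1 := by
  induction hk : T.card using Nat.strong_induction_on generalizing S T with
  | _ k ih =>
  subst hk
  by_cases hstab : ∀ e ∈ S, ∀ u ∈ T, e * u ∈ S
  · have hT1 : T = {1} := by
      refine Finset.eq_singleton_iff_unique_mem.2 ⟨h1, fun u hu => ?_⟩
      by_contra hu1
      have hle : S.card ≤ (S * T).card :=
        Finset.card_le_card (Finset.subset_mul_left S h1)
      refine hS.ne_empty (Finset.eq_empty_of_mul_mem_of_card_lt_orderOf (u := u) ?_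
        fun x hx => hstab x hx u hu)
      exact (hT u hu hu1).imp_right fun h => by omega
    subst hT1
    simp
  · push Not at hstab
    obtain ⟨e, he, u, hu, heu⟩ := hstab
    let p : Finset G × Finset G := Finset.mulDysonETransform e (S, T)
    have hsub : p.1 * p.2 ⊆ S * T := Finset.mulDysonETransform.subset e (S, T)
    have hcard : p.1.card + p.2.card = S.card + T.card :=
      Finset.mulDysonETransform.card e (S, T)
    have hp2 : p.2 = T ∩ e⁻¹ • S := rfl
    have hp1 : p.1 = S ∪ e • T := rfl
    have hmem : ∀ v, v ∈ p.2 ↔ v ∈ T ∧ e * v ∈ S := by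
      intro v
      rw [hp2, Finset.mem_inter, Finset.mem_inv_smul_finset_iff, smul_eq_mul]
    have hlt : p.2.card < T.card := by
      refine Finset.card_lt_card (Finset.ssubset_iff_subset_ne.2
        ⟨fun v hv => ((hmem v).1 hv).1, fun h => heu ?_⟩)
      exact ((hmem u).1 (h ▸ hu)).2
    have hle := Finset.card_le_card hsub
    have key := ih p.2.card hlt (S := p.1) (T := p.2)
      (hp1 ▸ hS.mono Finset.subset_union_left)
      ((hmem 1).2 ⟨h1, by simpa using he⟩)
      (fun v hv => hT v ((hmem v).1 hv).1) (hle.trans hn) rfl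
    omega

open scoped Pointwise in
/-- If `B` is a Chowla subset of `G` (every element of `B` has order greater than `|B|`,
where an element of infinite order has `orderOf b = 0`), then there is a matching from
`A` to `B`. -/
theorem stmt_4 {G : Type*} [CommGroup G]
    (A B : Finset G) (hA : A.Nonempty) (hB : B.Nonempty) (hcard : A.card = B.card)
    (h1 : (1 : G) ∉ B)
    (hChowla : ∀ b ∈ B, orderOf b = 0 ∨ B.card < orderOf b) :
    ∃ f : G → G, Set.BijOn f ↑A ↑B ∧ ∀ a ∈ A, a * f a ∉ A := by
  classical
  let t : A → Finset G := fun a => B.filter fun b => (a : G) * b ∉ A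
  have hall : ∀ s : Finset A, s.card ≤ (s.biUnion t).card := by
    intro s
    rcases s.eq_empty_or_nonempty with rfl | hs
    · simp
    let S : Finset G := s.map (Function.Embedding.subtype _)
    let U : Finset G := B.filter fun b => ∀ a ∈ s, (a : G) * b ∈ A
    have hunion : s.biUnion t = B \ U := by
      ext b
      simp only [t, U, Finset.mem_biUnion, Finset.mem_filter, Finset.mem_sdiff, not_and,
        not_forall]
      constructor
      · rintro ⟨a, ha, hb, hab⟩
        exact ⟨hb, fun _ => ⟨a, ha, hab⟩⟩
      · rintro ⟨hb, h⟩
        obtain ⟨a, ha, hab⟩ := h hb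
        exact ⟨a, ha, hb, hab⟩
    have hUB : U ⊆ B := Finset.filter_subset _ _
    have hU1 : (1 : G) ∉ U := fun h => h1 (hUB h)
    have hsub : S * insert 1 U ⊆ A := by
      intro x hx
      obtain ⟨y, hy, u, hu, rfl⟩ := Finset.mem_mul.1 hx
      obtain ⟨a, ha, rfl⟩ := Finset.mem_map.1 hy
      rcases Finset.mem_insert.1 hu with rfl | hu
      · simp
      · exact (Finset.mem_filter.1 hu).2 a ha
    have hle := Finset.card_le_card hsub
    have key := Finset.card_add_card_le_card_mul_add_one (n := B.card) (S := S)
      (T := insert 1 U) (hs.map) (Finset.mem_insert_self _ _)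
      (fun u hu hu1 => hChowla u (hUB (Finset.mem_of_mem_insert_of_ne hu hu1)))
      (hle.trans hcard.le)
    have hSc : S.card = s.card := Finset.card_map _
    rw [Finset.card_insert_of_notMem hU1] at key
    rw [hunion, Finset.card_sdiff_of_subset hUB]
    omega
  obtain ⟨g, hg, hgt⟩ := (Finset.all_card_le_biUnion_card_iff_exists_injective t).1 hall
  let f : G → G := fun a => if h : a ∈ A then g ⟨a, h⟩ else 1
  have hf : ∀ a (h : a ∈ A), f a = g ⟨a, h⟩ := fun a h => dif_pos h
  have hmaps : Set.MapsTo f A B := fun a ha => by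
    rw [hf a ha]
    exact (Finset.mem_filter.1 (hgt ⟨a, ha⟩)).1
  have hinj : Set.InjOn f A := fun a ha b hb hab => by
    rw [hf a ha, hf b hb] at hab
    exact congrArg Subtype.val (hg hab)
  refine ⟨f, ⟨hmaps, hinj, Finset.surjOn_of_injOn_of_card_le f hmaps hinj hcard.ge⟩, ?_⟩
  intro a ha
  rw [hf a ha]
  exact (Finset.mem_filter.1 (hgt ⟨a, ha⟩)).2
end

section
/- Let A and B be nonempty finite subsets of an abelian group G such that 1 ∉ B and |A| = |B| = n, where n is strictly less than the smallest cardinality of a nontrivial subgroup of G. Then there exists a matching from A to B. -/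
open scoped Pointwise in
/-- If `S * b ⊆ A` for every `b ∈ U`, where `1 ∉ U` and `A` has fewer elements than every nontrivial
subgroup, then `|S| + |U| ≤ |A|`. -/
theorem card_add_card_le_of_mul_mem {G : Type*} [CommGroup G] {A S U : Finset G}
    (hsmall : (A.card : ℕ∞) < Monoid.minOrder G) (hS : S.Nonempty) (hSA : S ⊆ A)
    (h1 : (1 : G) ∉ U) (hU : ∀ a ∈ S, ∀ b ∈ U, a * b ∈ A) :
    S.card + U.card ≤ A.card := by
  classical
  have hsub : S * insert 1 U ⊆ A := by
    intro x hx
    obtain ⟨a, ha, b, hb, rfl⟩ := Finset.mem_mul.1 hx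
    rcases Finset.mem_insert.1 hb with rfl | hb
    · simpa using hSA ha
    · exact hU a ha b hb
  have hle := (cauchy_davenport_minOrder_mul hS (Finset.insert_nonempty 1 U)).trans
    (Nat.cast_le.2 (Finset.card_le_card hsub))
  rw [Finset.card_insert_of_notMem h1] at hle
  rcases min_le_iff.1 hle with h | h
  · exact absurd h hsmall.not_ge
  · have := Nat.cast_le.1 h
    omega

/-- If `|A| = |B| = n` is strictly smaller than the cardinality of every nontrivial
subgroup of `G` (infinite subgroups counting as larger), and `1 ∉ B`, then there is a
matching from `A` to `B`. -/
theorem stmt_5 {G : Type*} [CommGroup G]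
    (A B : Finset G) (hA : A.Nonempty) (hB : B.Nonempty) (hcard : A.card = B.card)
    (h1 : (1 : G) ∉ B)
    (hsmall : ∀ H : Subgroup G, H ≠ ⊥ → ((H : Set G).Infinite ∨ A.card < Nat.card H)) :
    ∃ f : G → G, Set.BijOn f ↑A ↑B ∧ ∀ a ∈ A, a * f a ∉ A := by
  classical
  have hmin : (A.card : ℕ∞) < Monoid.minOrder G := by
    have : ((A.card + 1 : ℕ) : ℕ∞) ≤ Monoid.minOrder G :=
      Monoid.le_minOrder_iff_forall_subgroup.2 fun H hH hfin =>
        Nat.cast_le.2 ((hsmall H hH).resolve_left fun hinf => hinf hfin)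
    exact (Nat.cast_lt.2 A.card.lt_succ_self).trans_le this
  obtain ⟨g, hginj, hg⟩ := (Finset.all_card_le_biUnion_card_iff_exists_injective
    fun a : A => B.filter fun b => (a : G) * b ∉ A).1 (by
      intro S
      rcases S.eq_empty_or_nonempty with rfl | hS
      · simp
      set T := S.biUnion fun a : A => B.filter fun b => (a : G) * b ∉ A
      have hTB : T ⊆ B := Finset.biUnion_subset.2 fun _ _ => Finset.filter_subset _ _
      have key := card_add_card_le_of_mul_mem (S := S.map (Function.Embedding.subtype _))
        (U := B \ T) hmin (by simpa using hS) (by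
          intro x hx
          obtain ⟨a, -, rfl⟩ := Finset.mem_map.1 hx
          exact a.2) (fun h => h1 (Finset.mem_sdiff.1 h).1) (by
          intro x hx b hb
          obtain ⟨a, ha, rfl⟩ := Finset.mem_map.1 hx
          obtain ⟨hbB, hbT⟩ := Finset.mem_sdiff.1 hb
          by_contra hab
          exact hbT (Finset.mem_biUnion.2 ⟨a, ha, Finset.mem_filter.2 ⟨hbB, hab⟩⟩))
      rw [Finset.card_map] at key
      have := Finset.card_sdiff_add_card_eq_card hTB
      omega)
  have hgB (a : A) : g a ∈ B := (Finset.mem_filter.1 (hg a)).1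
  let f : G → G := fun a => if h : a ∈ A then g ⟨a, h⟩ else 1
  have hf {a : G} (h : a ∈ A) : f a = g ⟨a, h⟩ := dif_pos h
  have hmaps : Set.MapsTo f A B := fun a ha => by
    rw [hf ha]
    exact hgB _
  have hinj : Set.InjOn f A := fun a ha b hb hab => by
    rw [hf ha, hf hb] at hab
    exact congrArg Subtype.val (hginj hab)
  refine ⟨f, ⟨hmaps, hinj, Finset.surjOn_of_injOn_of_card_le f hmaps hinj hcard.ge⟩,
    fun a ha => ?_⟩
  rw [hf ha]
  exact (Finset.mem_filter.1 (hg ⟨a, ha⟩)).2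
end

section
/- Let A be a nonempty finite subset of an abelian group G such that 1 ∉ A. Then there exists a matching from A to itself, i.e., a bijection f : A → A such that a·f(a) ∉ A for all a ∈ A. -/
open scoped Pointwise in
/-- Scherk's theorem: if `1 = a * b` with `a ∈ A`, `b ∈ B` only for `a = b = 1`, then
`#A + #B ≤ #(A * B) + 1`. -/
theorem card_add_card_le_card_mul_add_one {G : Type*} [CommGroup G] [DecidableEq G]
    (A B : Finset G) (hA : 1 ∈ A) (hB : 1 ∈ B)
    (h : ∀ a ∈ A, ∀ b ∈ B, a * b = 1 → b = 1) :
    A.card + B.card ≤ (A * B).card + 1 := by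
  induction hn : B.card using Nat.strong_induction_on generalizing A B with
  | _ n ih =>
  subst hn
  by_cases hs : ∀ e ∈ A, ∀ b ∈ B, e * b ∈ A
  · have hB1 : B ⊆ {1} := by
      intro b hb
      have himg : A.image (· * b) = A :=
        Finset.eq_of_subset_of_card_le
          (Finset.image_subset_iff.2 fun a ha ↦ hs a ha b hb)
          (Finset.card_image_of_injective _ (mul_left_injective b)).ge
      obtain ⟨a, ha, hab⟩ := Finset.mem_image.1 (himg.symm ▸ hA)
      exact Finset.mem_singleton.2 (h a ha b hb hab)
    have hAB : A ⊆ A * B := fun a ha ↦ Finset.mem_mul.2 ⟨a, ha, 1, hB, mul_one a⟩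
    have hAcard := Finset.card_le_card hAB
    have hBcard := Finset.card_le_card hB1
    rw [Finset.card_singleton] at hBcard
    omega
  · push Not at hs
    obtain ⟨e, he, b, hb, heb⟩ := hs
    let A' := A ∪ e • B
    let B' := B ∩ e⁻¹ • A
    have hmem {x : G} : x ∈ B' ↔ x ∈ B ∧ e * x ∈ A := by
      simp [B', Finset.mem_inv_smul_finset_iff]
    have hlt : B'.card < B.card :=
      Finset.card_lt_card (Finset.ssubset_iff_subset_ne.2
        ⟨Finset.inter_subset_left, fun heq ↦ heb (hmem.1 (heq.symm ▸ hb)).2⟩)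
    have hcard : A'.card + B'.card = A.card + B.card :=
      Finset.mulDysonETransform.card e (A, B)
    have hsub : (A' * B').card ≤ (A * B).card :=
      Finset.card_le_card (Finset.mulDysonETransform.subset e (A, B))
    have key := ih B'.card hlt A' B' (Finset.mem_union_left _ hA)
      (hmem.2 ⟨hB, by simpa using he⟩) (by
        intro x hx y hy hxy
        rw [hmem] at hy
        rcases Finset.mem_union.1 hx with hx | hx
        · exact h x hx y hy.1 hxy
        · obtain ⟨z, hz, rfl⟩ := Finset.mem_smul_finset.1 hx
          have hzy : (e * y) * z = 1 := by
            rw [← hxy, smul_eq_mul, mul_right_comm]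
          have hz1 := h _ hy.2 z hz hzy
          exact h e he y hy.1 (by simpa [hz1] using hzy)) rfl
    omega

/-- If `1 ∉ A`, then there is a matching from `A` to itself. -/
theorem stmt_6 {G : Type*} [CommGroup G]
    (A : Finset G) (hA : A.Nonempty) (h1 : (1 : G) ∉ A) :
    ∃ f : G → G, Set.BijOn f ↑A ↑A ∧ ∀ a ∈ A, a * f a ∉ A := by
  classical
  let t : A → Finset G := fun a ↦ A.filter fun b ↦ (a : G) * b ∉ A
  have hall : ∀ s : Finset A, s.card ≤ (s.biUnion t).card := by
    intro s
    let S : Finset G := s.map (Function.Embedding.subtype _)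
    let U : Finset G := A \ s.biUnion t
    have hS : ∀ x ∈ S, x ∈ A := by
      intro x hx
      obtain ⟨y, -, rfl⟩ := Finset.mem_map.1 hx
      exact y.2
    have hU : ∀ x ∈ U, x ∈ A := fun x hx ↦ (Finset.mem_sdiff.1 hx).1
    have hSU : ∀ x ∈ S, ∀ y ∈ U, x * y ∈ A := by
      intro x hx y hy
      obtain ⟨z, hz, rfl⟩ := Finset.mem_map.1 hx
      by_contra hn
      exact (Finset.mem_sdiff.1 hy).2
        (Finset.mem_biUnion.2 ⟨z, hz, Finset.mem_filter.2 ⟨hU y hy, hn⟩⟩)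
    have key := card_add_card_le_card_mul_add_one (insert 1 S) (insert 1 U)
      (Finset.mem_insert_self _ _) (Finset.mem_insert_self _ _) (by
        intro x hx y hy hxy
        rcases Finset.mem_insert.1 hx with rfl | hx
        · simpa using hxy
        · rcases Finset.mem_insert.1 hy with rfl | hy
          · rfl
          · exact absurd (hxy ▸ hSU x hx y hy) h1)
    have hsub : Finset.image₂ (· * ·) (insert 1 S) (insert 1 U) ⊆ insert 1 A := by
      refine Finset.image₂_subset_iff.2 fun x hx y hy ↦ ?_
      rcases Finset.mem_insert.1 hx with rfl | hx <;>
        rcases Finset.mem_insert.1 hy with rfl | hy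
      · simp
      · simpa using Or.inr (hU y hy)
      · simpa using Or.inr (hS x hx)
      · exact Finset.mem_insert_of_mem (hSU x hx y hy)
    have hle := key.trans (Nat.add_le_add_right (Finset.card_le_card hsub) 1)
    rw [Finset.card_insert_of_notMem h1,
      Finset.card_insert_of_notMem fun h ↦ h1 (hS 1 h),
      Finset.card_insert_of_notMem fun h ↦ h1 (hU 1 h)] at hle
    have hScard : S.card = s.card := Finset.card_map _
    have hUcard : A.card - (s.biUnion t).card ≤ U.card := Finset.le_card_sdiff _ _
    have hAcard : (s.biUnion t).card ≤ A.card :=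
      Finset.card_le_card (Finset.biUnion_subset.2 fun _ _ ↦ Finset.filter_subset _ _)
    omega
  obtain ⟨g, hg, hgt⟩ := (Finset.all_card_le_biUnion_card_iff_exists_injective t).1 hall
  let f : G → G := fun x ↦ if hx : x ∈ A then g ⟨x, hx⟩ else x
  have hf {x : G} (hx : x ∈ A) : f x = g ⟨x, hx⟩ := dif_pos hx
  have hft {x : G} (hx : x ∈ A) : f x ∈ A ∧ x * f x ∉ A := by
    rw [hf hx]
    exact Finset.mem_filter.1 (hgt ⟨x, hx⟩)
  have hmaps : Set.MapsTo f A A := fun x hx ↦ (hft hx).1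
  have hinj : Set.InjOn f A := by
    intro x hx y hy hxy
    rw [hf hx, hf hy] at hxy
    exact congrArg Subtype.val (hg hxy)
  exact ⟨f, ⟨hmaps, hinj, Finset.surjOn_of_injOn_of_card_le f hmaps hinj le_rfl⟩,
    fun a ha ↦ (hft ha).2⟩
end

section
/- Let A and B be nonempty finite subsets of an abelian group G such that |A| = |B| and 1 ∉ B. Assume that A is a Sidon set. Then there are at least (|A| − 1)! matchings from A to B. -/
/-- Permutations avoiding a relabelling of `R` by `e` inject into those avoiding `R`. -/
lemma card_perm_avoiding_comp_le {α : Type*} [Finite α] (e : Equiv.Perm α) (R : α → α → Prop) :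
    Nat.card {σ : Equiv.Perm α // ∀ b, ¬ R (e b) (σ b)} ≤
      Nat.card {σ : Equiv.Perm α // ∀ b, ¬ R b (σ b)} := by
  refine Nat.card_le_card_of_injective
    (fun σ => ⟨e.symm.trans σ.1, fun b => by simpa using σ.2 (e.symm b)⟩) ?_
  intro σ τ h
  have h' := congrArg Subtype.val h
  ext b
  simpa using Equiv.congr_fun h' (e b)

/-- Expansion of the count of permutations avoiding `R` along the image of `0`. -/
lemma mul_le_card_perm_avoiding {n k m : ℕ} (R : Fin (n + 1) → Fin (n + 1) → Prop)
    (hk : k ≤ Nat.card {p // ¬ R 0 p})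
    (hm : ∀ p, ¬ R 0 p → m ≤ Nat.card {τ : Equiv.Perm (Fin n) //
      ∀ b, ¬ R b.succ (Equiv.swap 0 p (τ b).succ)}) :
    k * m ≤ Nat.card {σ : Equiv.Perm (Fin (n + 1)) // ∀ b, ¬ R b (σ b)} := by
  classical
  have hle : Nat.card (Σ p : {p // ¬ R 0 p}, {τ : Equiv.Perm (Fin n) //
      ∀ b, ¬ R b.succ (Equiv.swap 0 p.1 (τ b).succ)}) ≤
      Nat.card {σ : Equiv.Perm (Fin (n + 1)) // ∀ b, ¬ R b (σ b)} := by
    refine Nat.card_le_card_of_injective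
      (fun x => ⟨Equiv.Perm.decomposeFin.symm (x.1.1, x.2.1), fun b => ?_⟩) ?_
    · refine Fin.cases ?_ (fun i => ?_) b
      · simpa using x.1.2
      · simpa using x.2.2 i
    · rintro ⟨⟨p, hp⟩, ⟨τ, hτ⟩⟩ ⟨⟨q, hq⟩, ⟨ρ, hρ⟩⟩ h
      have h' := Equiv.Perm.decomposeFin.symm.injective (congrArg Subtype.val h)
      simp only [Prod.mk.injEq] at h'
      obtain ⟨rfl, rfl⟩ := h'
      rfl
  refine le_trans ?_ hle
  rw [Nat.card_sigma]
  calc k * m ≤ Nat.card {p // ¬ R 0 p} * m := Nat.mul_le_mul_right m hk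
    _ = ∑ _p : {p // ¬ R 0 p}, m := by simp [Nat.card_eq_fintype_card]
    _ ≤ _ := Finset.sum_le_sum fun p _ => hm p.1 p.2

lemma le_card_not_of_subsingleton {n : ℕ} (P : Fin (n + 1) → Prop)
    (hP : ∀ a a', P a → P a' → a = a') : n ≤ Nat.card {p // ¬ P p} := by
  classical
  have h : Fintype.card {p // P p} ≤ 1 :=
    Fintype.card_le_one_iff.2 fun a b => Subtype.ext (hP _ _ a.2 b.2)
  rw [Nat.card_eq_fintype_card, Fintype.card_subtype_compl, Fintype.card_fin]
  omega

/-- If `R` relates each `b` to at most one `a`, and no `a` is related to every `b`, then at least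
`n!` permutations of `Fin (n + 1)` avoid `R`. -/
theorem factorial_le_card_perm_avoiding (n : ℕ) (R : Fin (n + 1) → Fin (n + 1) → Prop)
    (hR : ∀ b a a', R b a → R b a' → a = a') (hne : ∀ a, ∃ b, ¬ R b a) :
    n.factorial ≤ Nat.card {σ : Equiv.Perm (Fin (n + 1)) // ∀ b, ¬ R b (σ b)} := by
  induction n with
  | zero =>
    obtain ⟨b, hb⟩ := hne 0
    have : Nonempty {σ : Equiv.Perm (Fin 1) // ∀ b, ¬ R b (σ b)} :=
      ⟨1, fun c => by simpa [Fin.fin_one_eq_zero] using hb⟩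
    exact Nat.card_pos
  | succ n ih =>
    obtain rfl | hn := Nat.eq_zero_or_pos n
    · have : Nonempty {σ : Equiv.Perm (Fin 2) // ∀ b, ¬ R b (σ b)} := by
        by_cases h : ∀ b, ¬ R b b
        · exact ⟨1, h⟩
        · refine ⟨Equiv.swap 0 1, ?_⟩
          have h0 := hR 0 0 1
          have h1 := hR 1 0 1
          simp only [Nat.reduceAdd, Fin.forall_fin_two, Fin.exists_fin_two] at h hne
          simp only [Nat.reduceAdd, Fin.forall_fin_two, Equiv.swap_apply_left,
            Equiv.swap_apply_right]
          have : (0 : Fin 2) ≠ 1 := by decide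
          tauto
      exact Nat.card_pos
    · obtain ⟨b, hb⟩ : ∃ b, ∀ a, ∃ b', b' ≠ b ∧ ¬ R b' a := by
        by_contra! hcon
        obtain ⟨c, hc⟩ := hcon 0
        obtain ⟨d, hd⟩ := hcon 1
        let t : Fin (n + 1 + 1) := ⟨2, by omega⟩
        have ht0 : t ≠ 0 := by simp [t, Fin.ext_iff]
        have ht1 : t ≠ 1 := by simp [t, Fin.ext_iff]
        obtain rfl := hR t c d (hc t ht0) (hd t ht1)
        obtain ⟨b, hb⟩ := hne c
        by_cases h0 : b = 0
        · subst h0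
          exact hb (hd 0 (by simp))
        · exact hb (hc b h0)
      refine le_trans ?_ (card_perm_avoiding_comp_le (Equiv.swap 0 b) R)
      rw [Nat.factorial_succ]
      refine mul_le_card_perm_avoiding (fun b' a => R (Equiv.swap 0 b b') a)
        (le_card_not_of_subsingleton _ fun a a' => hR _ a a') fun p _ => ?_
      refine ih (fun i j => R (Equiv.swap 0 b i.succ) (Equiv.swap 0 p j.succ)) ?_ ?_
      · intro i j j' h h'
        exact Fin.succ_injective _ ((Equiv.swap 0 p).injective (hR _ _ _ h h'))
      · intro j
        obtain ⟨b', hb', hRb'⟩ := hb (Equiv.swap 0 p j.succ)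
        have h0 : Equiv.swap 0 b b' ≠ 0 := by
          intro h
          rw [Equiv.swap_apply_eq_iff, Equiv.swap_apply_left] at h
          exact hb' h
        obtain ⟨i, hi⟩ := Fin.exists_succ_eq.2 h0
        exact ⟨i, by rwa [hi, Equiv.swap_apply_self]⟩

/-- A non-identity element translates at most one element of a Sidon set into that set. -/
lemma eq_of_mul_mem_of_sidon {G : Type*} [CommGroup G] {A : Finset G}
    (hSidon : ∀ a ∈ A, ∀ b ∈ A, ∀ c ∈ A, ∀ d ∈ A,
      a * b = c * d → (a = c ∧ b = d) ∨ (a = d ∧ b = c))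
    {x a a' : G} (hx : x ≠ 1) (ha : a ∈ A) (ha' : a' ∈ A) (hax : a * x ∈ A) (hax' : a' * x ∈ A) :
    a = a' := by
  rcases hSidon a ha _ hax' a' ha' _ hax (by rw [mul_left_comm]) with h | h
  · exact h.1
  · exact absurd (left_eq_mul.1 h.1) hx

/-- If `A` and `B` have the same size and `1 ∉ B`, no element of `A` translates `B` into `A`. -/
lemma exists_mul_notMem_of_one_notMem {G : Type*} [CommGroup G] {A B : Finset G}
    (hcard : A.card = B.card) (h1 : (1 : G) ∉ B) {a : G} (ha : a ∈ A) :
    ∃ b ∈ B, a * b ∉ A := by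
  by_contra! h
  obtain ⟨b, hb, hab⟩ := Finset.surj_on_of_inj_on_of_card_le (fun b _ => a * b) h
    (fun _ _ _ _ => mul_left_cancel) hcard.le a ha
  exact h1 (left_eq_mul.1 hab ▸ hb)

/-- If `A` is a Sidon set, then there are at least `(|A| - 1)!` matchings from `A` to `B`,
a matching being a bijection `f : A → B` with `a * f a ∉ A` for all `a ∈ A`. -/
theorem stmt_7 {G : Type*} [CommGroup G]
    (A B : Finset G) (hA : A.Nonempty) (hB : B.Nonempty) (hcard : A.card = B.card)
    (h1 : (1 : G) ∉ B)
    (hSidon : ∀ a ∈ A, ∀ b ∈ A, ∀ c ∈ A, ∀ d ∈ A,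
      a * b = c * d → (a = c ∧ b = d) ∨ (a = d ∧ b = c)) :
    Nat.factorial (A.card - 1) ≤
      Nat.card {f : ↥A ≃ ↥B // ∀ a : ↥A, (a : G) * ((f a : G)) ∉ A} := by
  obtain ⟨n, hn⟩ := Nat.exists_eq_add_one.2 hA.card_pos
  let eA : A ≃ Fin (n + 1) := A.equivFinOfCardEq hn
  let eB : B ≃ Fin (n + 1) := B.equivFinOfCardEq (hcard ▸ hn)
  rw [hn, Nat.add_sub_cancel]
  refine (factorial_le_card_perm_avoiding n
    (fun b a => (eA.symm a : G) * (eB.symm b : G) ∈ A) ?_ ?_).trans ?_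
  · intro b a a' h h'
    exact eA.symm.injective (Subtype.ext (eq_of_mul_mem_of_sidon hSidon
      (fun hb => h1 (hb ▸ (eB.symm b).2)) (eA.symm a).2 (eA.symm a').2 h h'))
  · intro a
    obtain ⟨b, hb, hab⟩ := exists_mul_notMem_of_one_notMem hcard h1 (eA.symm a).2
    exact ⟨eB ⟨b, hb⟩, by simpa using hab⟩
  · refine Nat.card_le_card_of_injective
      (fun σ => ⟨(eA.trans σ.1.symm).trans eB.symm, fun a => ?_⟩) ?_
    · simpa using σ.2 (σ.1.symm (eA a))
    · intro σ τ h
      have h' := congrArg Subtype.val h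
      refine Subtype.ext (Equiv.symm_bijective.injective (Equiv.ext fun a => ?_))
      simpa using Equiv.congr_fun h' (eA.symm a)
end

section
/- Let A and B be nonempty finite subsets of an abelian group G such that |A| = |B| and 1 ∉ B. Assume that for every a ∈ G and every nontrivial proper finite subgroup H of G, we have |aH ∩ A| + |H ∩ B| < |H| + 1. Then there exists a matching from A to B. -/
open Pointwise

/-- If `S * V` lies in a set `C` with fewer than `|S| + |V| - 1` elements and `1 ∈ V`, then `C`
contains a coset of a finite subgroup meeting `V` nontrivially. -/
theorem exists_subgroup_smul_subset_of_card_lt {G : Type*} [CommGroup G] [DecidableEq G]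
    (C V S : Finset G) (hS : S.Nonempty) (h1 : (1 : G) ∈ V) (hSV : S * V ⊆ C)
    (hcard : C.card + 1 < S.card + V.card) :
    ∃ H : Subgroup G, (H : Set G).Finite ∧ (∃ v ∈ V, v ≠ 1 ∧ v ∈ H) ∧
      ∃ a : G, a • (H : Set G) ⊆ C := by
  induction V using Finset.strongInduction generalizing S with
  | H V ih =>
    have hSC : S ⊆ C := (Finset.subset_mul_left S h1).trans hSV
    by_cases hcl : ∀ e ∈ S, ∀ v ∈ V, e * v ∈ S
    · obtain ⟨a, ha⟩ := hS
      have hmul : ∀ h ∈ MulAction.stabilizer G S, a * h ∈ S := fun h hh ↦ by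
        rw [← MulAction.mem_stabilizer_iff.1 hh, mul_comm]
        exact Finset.smul_mem_smul_finset ha
      refine ⟨MulAction.stabilizer G S, ?_, ?_, a, ?_⟩
      · exact Set.Finite.of_injOn (f := (a * ·)) (fun h hh ↦ hmul h hh)
          (mul_right_injective a).injOn S.finite_toSet
      · have hV : 1 < V.card := by
          have := Finset.card_le_card hSC
          omega
        obtain ⟨v, hv, hv1⟩ := Finset.exists_mem_ne hV 1
        refine ⟨v, hv, hv1, Finset.eq_of_subset_of_card_le ?_ (Finset.card_smul_finset v S).ge⟩
        intro x hx
        obtain ⟨e, he, rfl⟩ := Finset.mem_smul_finset.1 hx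
        simpa [mul_comm] using hcl e he v hv
      · rintro _ ⟨h, hh, rfl⟩
        exact hSC (hmul h hh)
    · push Not at hcl
      obtain ⟨e, he, v, hv, hev⟩ := hcl
      have hcard' := Finset.mulDysonETransform.card e (S, V)
      have hsub := Finset.mulDysonETransform.subset e (S, V)
      have hne : V ∩ e⁻¹ • S ≠ V := fun h ↦ hev <| by
        simpa [Finset.mem_inv_smul_finset_iff] using Finset.inter_eq_left.1 h hv
      obtain ⟨H, hH, ⟨w, hw, hwH⟩, hC⟩ := ih (V ∩ e⁻¹ • S)
        (Finset.ssubset_iff_subset_ne.2 ⟨Finset.inter_subset_left, hne⟩) (S ∪ e • V)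
        (hS.mono Finset.subset_union_left)
        (Finset.mem_inter.2 ⟨h1, Finset.mem_inv_smul_finset_iff.2 (by simpa using he)⟩)
        (hsub.trans hSV) (by simp only [Finset.mulDysonETransform] at hcard'; omega)
      exact ⟨H, hH, ⟨w, Finset.inter_subset_left hw, hwH⟩, hC⟩

/-- If for every `a ∈ G` and every nontrivial proper finite subgroup `H` of `G` one has
`|aH ∩ A| + |H ∩ B| < |H| + 1`, then there is a matching from `A` to `B`. -/
theorem stmt_9 {G : Type*} [CommGroup G]
    (A B : Finset G) (hA : A.Nonempty) (hB : B.Nonempty) (hcard : A.card = B.card)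
    (h1 : (1 : G) ∉ B)
    (hineq : ∀ (a : G) (H : Subgroup G), H ≠ ⊥ → H ≠ ⊤ → (H : Set G).Finite →
      Nat.card ↥(a • (H : Set G) ∩ ↑A) + Nat.card ↥((H : Set G) ∩ ↑B) < Nat.card H + 1) :
    ∃ f : G → G, Set.BijOn f ↑A ↑B ∧ ∀ a ∈ A, a * f a ∉ A := by
  classical
  let t : A → Finset G := fun a ↦ B.filter fun b ↦ (a : G) * b ∉ A
  have hall : ∀ s : Finset A, s.card ≤ (s.biUnion t).card := by
    intro s
    by_contra! hlt
    let S : Finset G := s.map (Function.Embedding.subtype _)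
    let U : Finset G := B \ s.biUnion t
    have hU1 : (1 : G) ∉ U := fun h ↦ h1 (Finset.sdiff_subset h)
    have hScard : S.card = s.card := Finset.card_map _
    have hUcard : U.card + (s.biUnion t).card = B.card :=
      Finset.card_sdiff_add_card_eq_card
        (Finset.biUnion_subset.2 fun _ _ ↦ Finset.filter_subset _ _)
    have hSU : S * insert 1 U ⊆ A := by
      intro x hx
      obtain ⟨y, hy, z, hz, rfl⟩ := Finset.mem_mul.1 hx
      obtain ⟨a, ha, rfl⟩ := Finset.mem_map.1 hy
      rcases Finset.mem_insert.1 hz with rfl | hz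
      · simp
      · by_contra hn
        obtain ⟨hzB, hzt⟩ := Finset.mem_sdiff.1 hz
        exact hzt (Finset.mem_biUnion.2 ⟨a, ha, Finset.mem_filter.2 ⟨hzB, hn⟩⟩)
    obtain ⟨H, hH, ⟨v, hv, hv1, hvH⟩, a, ha⟩ :=
      exists_subgroup_smul_subset_of_card_lt A (insert 1 U) S
        (Finset.card_pos.1 (by omega)) (Finset.mem_insert_self _ _) hSU
        (by rw [Finset.card_insert_of_notMem hU1]; omega)
    have hvB : v ∈ B := Finset.sdiff_subset ((Finset.mem_insert.1 hv).resolve_left hv1)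
    have hbot : H ≠ ⊥ := by
      rintro rfl
      exact hv1 (Subgroup.mem_bot.1 hvH)
    have htop : H ≠ ⊤ := by
      rintro rfl
      have hAuniv : ∀ x, x ∈ A := fun x ↦
        ha (Set.mem_smul_set_iff_inv_smul_mem.2 (Subgroup.mem_top _))
      have hBA : B = A := Finset.eq_of_subset_of_card_le (fun x _ ↦ hAuniv x) hcard.le
      exact h1 (hBA ▸ hAuniv 1)
    have hlt' := hineq a H hbot htop hH
    have hpos : 0 < Nat.card ↥((H : Set G) ∩ ↑B) := by
      have : Finite ↥((H : Set G) ∩ ↑B) := hH.inter_of_left _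
      exact Nat.card_pos_iff.2 ⟨⟨v, hvH, hvB⟩, this⟩
    have hcoset : Nat.card ↥(a • (H : Set G)) = Nat.card H := Set.natCard_smul_set a _
    rw [Set.inter_eq_left.2 ha, hcoset] at hlt'
    omega
  obtain ⟨f, hf, hft⟩ := (Finset.all_card_le_biUnion_card_iff_exists_injective t).1 hall
  let g : G → G := fun x ↦ if h : x ∈ A then f ⟨x, h⟩ else 1
  have hg : ∀ x (h : x ∈ A), g x = f ⟨x, h⟩ := fun x h ↦ dif_pos h
  have hmaps : ∀ x ∈ A, g x ∈ B ∧ x * g x ∉ A := fun x hx ↦ by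
    rw [hg x hx]
    exact Finset.mem_filter.1 (hft ⟨x, hx⟩)
  have hinj : Set.InjOn g A := fun x hx y hy hxy ↦ by
    rw [hg x hx, hg y hy] at hxy
    exact congrArg Subtype.val (hf hxy)
  exact ⟨g, ⟨fun x hx ↦ (hmaps x hx).1, hinj,
    Finset.surjOn_of_injOn_of_card_le g (fun x hx ↦ (hmaps x hx).1) hinj hcard.ge⟩,
    fun x hx ↦ (hmaps x hx).2⟩
end

section
/- Let K ⊆ L be a field extension, let A and B be n-dimensional K-subspaces of L with n > 0, and suppose that A is matched to B. Then 1 ∉ B. -/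
/-- An ordered basis `a : Fin n → L` of the `K`-subspace `A` is matched to an ordered
basis `b : Fin n → L` of `B` if `(a i)⁻¹ A ∩ B ⊆ span (b j : j ≠ i)` for each `i`.
`A` is matched to `B` if every ordered basis of `A` can be matched to some ordered
basis of `B`. -/
def IsMatchedTo {K L : Type*} [Field K] [Field L] [Algebra K L]
    (A B : Submodule K L) : Prop :=
  ∀ (n : ℕ) (a : Fin n → L), LinearIndependent K a → Submodule.span K (Set.range a) = A →
    ∃ b : Fin n → L, LinearIndependent K b ∧ Submodule.span K (Set.range b) = B ∧
      ∀ i : Fin n, ∀ x ∈ A, (a i)⁻¹ * x ∈ B →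
        (a i)⁻¹ * x ∈ Submodule.span K (b '' {j | j ≠ i})

/-- A vector lying in the span of every subfamily obtained by omitting one member of a
nonempty linearly independent family is zero. -/
theorem LinearIndependent.eq_zero_of_forall_mem_span_ne {ι R M : Type*} [Nonempty ι] [Ring R]
    [AddCommGroup M] [Module R M] {b : ι → M} (hb : LinearIndependent R b) {x : M}
    (hx : ∀ i, x ∈ Submodule.span R (b '' {j | j ≠ i})) : x = 0 := by
  choose l hl hlx using fun i => (Finsupp.mem_span_image_iff_linearCombination R).1 (hx i)
  obtain ⟨k⟩ := ‹Nonempty ι›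
  have hk : l k = 0 := by
    ext i
    have hki : l k = l i := hb ((hlx k).trans (hlx i).symm)
    rw [hki]
    exact Finsupp.notMem_support_iff.1 fun hi => hl i hi rfl
  rw [← hlx k, hk, map_zero]

/-- If `A` is matched to `B`, then `1 ∉ B`. -/
theorem stmt_10 {K L : Type*} [Field K] [Field L] [Algebra K L]
    (A B : Submodule K L) (n : ℕ) (hn : 0 < n)
    (hA : Module.finrank K A = n) (hB : Module.finrank K B = n)
    (h : IsMatchedTo A B) : (1 : L) ∉ B := by
  intro h_one
  have : Module.Finite K A := Module.finite_of_finrank_pos (hA ▸ hn)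
  have : Nonempty (Fin n) := ⟨⟨0, hn⟩⟩
  let e := Module.finBasisOfFinrankEq K A hA
  have he : LinearIndependent K (fun i => (e i : L)) :=
    e.linearIndependent.map' A.subtype A.ker_subtype
  have hspan : Submodule.span K (Set.range fun i => (e i : L)) = A := by
    have := congrArg (Submodule.map A.subtype) e.span_eq
    rwa [Submodule.map_span, ← Set.range_comp, Submodule.map_subtype_top] at this
  obtain ⟨b, hb, -, hab⟩ := h n _ he hspan
  refine one_ne_zero (hb.eq_zero_of_forall_mem_span_ne fun i => ?_)
  have hi : (e i : L)⁻¹ * e i = 1 := inv_mul_cancel₀ (he.ne_zero i)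
  simpa only [hi] using hab i (e i) (e i).2 (by rwa [hi])
end

section
/- Let K ⊊ L be a field extension, and let A and B be two n-dimensional K-subspaces of L, with n > 0 and 1 ∉ B. Then A is matched to B if and only if for every pair of nonzero K-subspaces S ⊆ A and R ⊆ B ⊕ K (the internal direct sum of B and the one-dimensional subspace K·1) with ⟨SR⟩ = S, we have dim S ≤ dim B − dim(R ∩ B). -/
open Pointwise

open Module

/-- One step of the linear Dyson transform preserves the sum of the dimensions. -/
theorem finrank_sup_map_add_finrank_inf_comap {K V : Type*} [Field K] [AddCommGroup V] [Module K V]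
    (f : V →ₗ[K] V) (hf : Function.Injective f) (S R : Submodule K V)
    [FiniteDimensional K S] [FiniteDimensional K R] :
    finrank K ↥(S ⊔ R.map f) + finrank K ↥(R ⊓ S.comap f) = finrank K S + finrank K R := by
  have h1 : finrank K ↥(R.map f) = finrank K R :=
    (Submodule.equivMapOfInjective f hf R).finrank_eq.symm
  have h2 : finrank K ↥((R ⊓ S.comap f).map f) = finrank K ↥(R ⊓ S.comap f) :=
    (Submodule.equivMapOfInjective f hf _).finrank_eq.symm
  have h3 : (R ⊓ S.comap f).map f = S ⊓ R.map f := by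
    ext x
    constructor
    · rintro ⟨y, ⟨hy, hy'⟩, rfl⟩
      exact ⟨hy', y, hy, rfl⟩
    · rintro ⟨hx, y, hy, rfl⟩
      exact ⟨y, ⟨hy, hx⟩, rfl⟩
  rw [← h2, h3, Submodule.finrank_sup_add_finrank_inf_eq, h1]

/-- Iterating the linear Dyson transform: any pair of subspaces `S`, `R` with `1 ∈ R` can be
replaced, without changing the sum of the dimensions, by a pair in which `R` stabilizes `S`. -/
theorem exists_mul_eq_left_of_one_mem {K L : Type*} [Field K] [Field L] [Algebra K L]
    (S R : Submodule K L) [FiniteDimensional K S] [FiniteDimensional K R] (h1 : (1 : L) ∈ R) :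
    ∃ S' R' : Submodule K L, S ≤ S' ∧ S' ≤ S * R ∧ R' ≤ R ∧ (1 : L) ∈ R' ∧ S' * R' = S' ∧
      finrank K S' + finrank K R' = finrank K S + finrank K R := by
  induction hd : finrank K R using Nat.strong_induction_on generalizing S R with
  | _ d ih =>
  have hSR : S ≤ S * R := fun s hs => by simpa using Submodule.mul_mem_mul hs h1
  by_cases hstab : S * R ≤ S
  · exact ⟨S, R, le_rfl, hSR, le_rfl, h1, le_antisymm hstab hSR, by rw [hd]⟩
  obtain ⟨e, he, r, hr, her⟩ : ∃ e ∈ S, ∃ r ∈ R, e * r ∉ S := by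
    simpa [Submodule.mul_le] using hstab
  have he0 : e ≠ 0 := by
    rintro rfl
    exact her (by simp)
  set f := LinearMap.mulLeft K e
  have hf : Function.Injective f := mul_right_injective₀ he0
  have hlt : R ⊓ S.comap f < R :=
    lt_of_le_of_ne inf_le_left fun h => her (inf_eq_left.mp h hr)
  have hdim := finrank_sup_map_add_finrank_inf_comap f hf S R
  have hone : (1 : L) ∈ R ⊓ S.comap f := ⟨h1, by simpa [f] using he⟩
  obtain ⟨S', R', hS, hS', hR, hR1, hmul, hfin⟩ :=
    ih _ (hd ▸ Submodule.finrank_lt_finrank_of_lt hlt) (S ⊔ R.map f) (R ⊓ S.comap f) hone rfl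
  refine ⟨S', R', le_sup_left.trans hS, hS'.trans ?_, hR.trans inf_le_left, hR1, hmul, ?_⟩
  · rw [Submodule.mul_le]
    intro u hu t ⟨htR, htS⟩
    obtain ⟨s, hs, _, ⟨r, hr, rfl⟩, rfl⟩ := Submodule.mem_sup.mp hu
    have h : e * t * r ∈ S * R := Submodule.mul_mem_mul htS hr
    rw [add_mul]
    refine add_mem (Submodule.mul_mem_mul hs htR) ?_
    simpa [f, mul_right_comm] using h
  · rw [hfin, hdim, hd]

/-- A subspace of dimension at least two is the sum of two proper subspaces. -/
theorem Submodule.exists_lt_lt_sup_eq {K V : Type*} [Field K] [AddCommGroup V] [Module K V]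
    (W : Submodule K V) (hW : 2 ≤ finrank K W) : ∃ H₁ < W, ∃ H₂ < W, H₁ ⊔ H₂ = W := by
  have hbot : W ≠ ⊥ := by
    rintro rfl
    simp at hW
  obtain ⟨x, hx, hx0⟩ := Submodule.exists_mem_ne_zero_of_ne_bot hbot
  obtain ⟨C, hC⟩ := (K ∙ x).exists_isCompl
  have hle : K ∙ x ≤ W := by simpa using hx
  refine ⟨K ∙ x, lt_of_le_of_ne hle ?_, C ⊓ W, lt_of_le_of_ne inf_le_right ?_, ?_⟩
  · rintro rfl
    rw [finrank_span_singleton hx0] at hW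
    omega
  · intro h
    exact hx0 (Submodule.disjoint_def.mp hC.disjoint x (Submodule.mem_span_singleton_self x)
      (inf_eq_right.mp h hx))
  · rw [← sup_inf_assoc_of_le C hle, hC.sup_eq_top, top_inf_eq]

/-- Rado's theorem for subspaces: a finite family of subspaces has a linearly independent
transversal as soon as any `k` of them span a subspace of dimension at least `k`. -/
theorem exists_linearIndependent_forall_mem {K V ι : Type*} [Field K] [AddCommGroup V] [Module K V]
    [FiniteDimensional K V] [Fintype ι] (W : ι → Submodule K V)
    (hW : ∀ J : Finset ι, J.card ≤ finrank K ↥(J.sup W)) :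
    ∃ w : ι → V, LinearIndependent K w ∧ ∀ i, w i ∈ W i := by
  classical
  induction hd : ∑ i, finrank K (W i) using Nat.strong_induction_on generalizing W with
  | _ d ih =>
  by_cases hbig : ∃ i, 2 ≤ finrank K (W i)
  · obtain ⟨i, hi⟩ := hbig
    obtain ⟨H₁, hH₁, H₂, hH₂, hsup⟩ := (W i).exists_lt_lt_sup_eq hi
    have sup_update (H : Submodule K V) (J : Finset ι) (hJ : i ∉ J) :
        J.sup (Function.update W i H) = J.sup W :=
      Finset.sup_congr rfl fun j hj => Function.update_of_ne (by rintro rfl; exact hJ hj) _ _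
    have shrink (H : Submodule K V) (hH : H < W i)
        (h : ∀ J : Finset ι, i ∉ J → J.card + 1 ≤ finrank K ↥(H ⊔ J.sup W)) :
        ∃ w : ι → V, LinearIndependent K w ∧ ∀ i, w i ∈ W i := by
      have hle : ∀ j, Function.update W i H j ≤ W j := by
        intro j
        obtain rfl | hj := eq_or_ne j i
        · simpa using hH.le
        · simp [hj]
      obtain ⟨w, hw, hmem⟩ := ih (∑ j, finrank K ↥(Function.update W i H j)) (by
        rw [← hd]
        refine Finset.sum_lt_sum (fun j _ => Submodule.finrank_mono (hle j))
          ⟨i, Finset.mem_univ i, ?_⟩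
        rw [Function.update_self]
        exact Submodule.finrank_lt_finrank_of_lt hH) (Function.update W i H) (by
        intro J
        by_cases hJ : i ∈ J
        · rw [← Finset.insert_erase hJ, Finset.card_insert_of_notMem (Finset.notMem_erase i J),
            Finset.sup_insert, Function.update_self, sup_update H _ (Finset.notMem_erase i J)]
          exact h _ (Finset.notMem_erase i J)
        · rw [sup_update H J hJ]
          exact hW J) rfl
      exact ⟨w, hw, fun j => hle j (hmem j)⟩
    by_contra hcon
    have fail₁ := mt (shrink H₁ hH₁) hcon
    have fail₂ := mt (shrink H₂ hH₂) hcon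
    push Not at fail₁ fail₂
    obtain ⟨J₁, hJ₁, hlt₁⟩ := fail₁
    obtain ⟨J₂, hJ₂, hlt₂⟩ := fail₂
    have hmod := Submodule.finrank_sup_add_finrank_inf_eq (H₁ ⊔ J₁.sup W) (H₂ ⊔ J₂.sup W)
    have hunion : (insert i (J₁ ∪ J₂)).sup W ≤ (H₁ ⊔ J₁.sup W) ⊔ (H₂ ⊔ J₂.sup W) := by
      rw [Finset.sup_insert, Finset.sup_union, ← hsup, sup_sup_sup_comm]
    have hinter : (J₁ ∩ J₂).sup W ≤ (H₁ ⊔ J₁.sup W) ⊓ (H₂ ⊔ J₂.sup W) :=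
      le_inf (le_sup_of_le_right (Finset.sup_mono Finset.inter_subset_left))
        (le_sup_of_le_right (Finset.sup_mono Finset.inter_subset_right))
    have hu := (hW _).trans (Submodule.finrank_mono hunion)
    have hn := (hW _).trans (Submodule.finrank_mono hinter)
    rw [Finset.card_insert_of_notMem (by simp [hJ₁, hJ₂])] at hu
    have := Finset.card_union_add_card_inter J₁ J₂
    omega
  · push Not at hbig
    have hone (i : ι) : finrank K (W i) = 1 := by
      have := hW {i}
      rw [Finset.sup_singleton, Finset.card_singleton] at this
      have := hbig i
      omega
    choose w hw0 hw using fun i => finrank_eq_one_iff'.mp (hone i)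
    refine ⟨fun i => w i, ?_, fun i => (w i).2⟩
    rw [linearIndependent_iff_card_le_finrank_span]
    refine (hW Finset.univ).trans (Submodule.finrank_mono (Finset.sup_le fun i _ x hx => ?_))
    obtain ⟨c, hc⟩ := hw i ⟨x, hx⟩
    have hcx : c • (w i : V) = x := congrArg Subtype.val hc
    rw [← hcx]
    exact Submodule.smul_mem _ c (Submodule.subset_span ⟨i, rfl⟩)

/-- The dual form of Rado's theorem: a basis avoiding a given family of subspaces coordinatewise. -/
theorem exists_basis_forall_repr_eq_zero {K V ι : Type*} [Field K] [AddCommGroup V] [Module K V]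
    [FiniteDimensional K V] [Fintype ι] (hcard : Fintype.card ι = finrank K V)
    (U : ι → Submodule K V)
    (hU : ∀ J : Finset ι, finrank K ↥(J.inf U) + J.card ≤ finrank K V) :
    ∃ b : Basis ι K V, ∀ i, ∀ x ∈ U i, b.repr x i = 0 := by
  classical
  have hsup (J : Finset ι) :
      J.sup (fun i => (U i).dualAnnihilator) = (J.inf U).dualAnnihilator := by
    induction J using Finset.induction_on with
    | empty => simp
    | insert i J _ ih =>
      rw [Finset.sup_insert, Finset.inf_insert, ih, Subspace.dualAnnihilator_inf_eq]
  obtain ⟨f, hf, hfU⟩ := exists_linearIndependent_forall_mem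
    (fun i => (U i).dualAnnihilator) (by
      intro J
      rw [hsup]
      have := Subspace.finrank_add_finrank_dualAnnihilator_eq (J.inf U)
      have := hU J
      omega)
  let F : Basis ι K (Dual K V) := Basis.mk hf
    (hf.span_eq_top_of_card_eq_finrank' (by rw [hcard, Subspace.dual_finrank_eq])).ge
  refine ⟨F.dualBasis.map (evalEquiv K V).symm, fun i x hx => ?_⟩
  have hrepr : (F.dualBasis.map (evalEquiv K V).symm).repr x i = f i x := by
    simp [F]
  rw [hrepr]
  exact (Submodule.mem_dualAnnihilator _).mp (hfU i) x hx

/-- A subspace contained in the span of all but one vector of an independent family, for each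
index in `J`, has dimension at most the number of the remaining indices. -/
theorem LinearIndependent.finrank_add_card_le {K V ι : Type*} [Field K] [AddCommGroup V]
    [Module K V] [Fintype ι] {b : ι → V} (hb : LinearIndependent K b) (J : Finset ι)
    (T : Submodule K V) (hT : T ≤ Submodule.span K (Set.range b))
    (h : ∀ i ∈ J, T ≤ Submodule.span K (b '' {j | j ≠ i})) :
    finrank K T + J.card ≤ Fintype.card ι := by
  classical
  have hle : T ≤ Submodule.span K (((Jᶜ).image b : Finset V) : Set V) := by
    intro x hx
    obtain ⟨l, rfl⟩ := (Finsupp.mem_span_range_iff_exists_finsupp).mp (hT hx)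
    rw [Finset.coe_image, Finsupp.mem_span_image_iff_linearCombination]
    refine ⟨l, fun i hi => ?_, rfl⟩
    rw [Finset.mem_coe, Finset.mem_compl]
    intro hiJ
    obtain ⟨l', hl', hll'⟩ := (Finsupp.mem_span_image_iff_linearCombination K).mp (h i hiJ hx)
    have : l' = l := hb hll'
    subst this
    exact hl' hi rfl
  have h1 := (Submodule.finrank_mono hle).trans (finrank_span_finset_le_card _)
  have h2 : ((Jᶜ).image b).card ≤ (Jᶜ).card := Finset.card_image_le
  have h3 := J.card_add_card_compl
  omega

/-- Every matched pair satisfies the dimension bound for products landing in `A`. -/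
theorem IsMatchedTo.finrank_add_finrank_le {K L : Type*} [Field K] [Field L] [Algebra K L]
    {A B : Submodule K L} [FiniteDimensional K A] (h : IsMatchedTo A B) {S T : Submodule K L}
    (hS : S ≤ A) (hT : T ≤ B) (hST : S * T ≤ A) :
    finrank K S + finrank K T ≤ finrank K B := by
  obtain ⟨C, hC⟩ := S.exists_isCompl
  have hsup : S ⊔ C ⊓ A = A := by
    rw [← sup_inf_assoc_of_le C hS, hC.sup_eq_top, top_inf_eq]
  have hdisj : Disjoint S (C ⊓ A) := hC.disjoint.mono_right inf_le_left
  have : FiniteDimensional K S := Submodule.finiteDimensional_of_le hS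
  have : FiniteDimensional K ↥(C ⊓ A) := Submodule.finiteDimensional_of_le inf_le_right
  let s : Fin (finrank K S) → L := fun i => finBasis K S i
  let c : Fin (finrank K ↥(C ⊓ A)) → L := fun i => finBasis K ↥(C ⊓ A) i
  have span_coe (W : Submodule K L) [FiniteDimensional K W] :
      Submodule.span K (Set.range fun i => (finBasis K W i : L)) = W := by
    have : (Set.range fun i => (finBasis K W i : L)) = W.subtype '' Set.range (finBasis K W) := by
      rw [← Set.range_comp]
      rfl
    rw [this, Submodule.span_image, (finBasis K W).span_eq, Submodule.map_subtype_top]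
  have hs : Submodule.span K (Set.range s) = S := span_coe S
  have hc : Submodule.span K (Set.range c) = C ⊓ A := span_coe (C ⊓ A)
  have hsli : LinearIndependent K s :=
    (finBasis K S).linearIndependent.map' S.subtype S.ker_subtype
  have hcli : LinearIndependent K c :=
    (finBasis K ↥(C ⊓ A)).linearIndependent.map' (C ⊓ A).subtype (C ⊓ A).ker_subtype
  let e := finSumFinEquiv (m := finrank K S) (n := finrank K ↥(C ⊓ A))
  obtain ⟨b, hb, hbB, hmatch⟩ := h _ (Sum.elim s c ∘ e.symm)
    ((hsli.sum_type hcli (by rwa [hs, hc])).comp _ e.symm.injective)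
    (by rw [e.symm.surjective.range_comp, Set.Sum.elim_range, Submodule.span_union, hs, hc, hsup])
  let J : Finset (Fin (finrank K S + finrank K ↥(C ⊓ A))) :=
    Finset.univ.map (Function.Embedding.inl.trans e.toEmbedding)
  have hJ : J.card = finrank K S := by simp [J]
  have hcard : finrank K B = Fintype.card (Fin (finrank K S + finrank K ↥(C ⊓ A))) := by
    rw [← hbB]
    exact finrank_span_eq_card hb
  have key := hb.finrank_add_card_le J T (hbB ▸ hT) (by
    intro i hi x hx
    obtain ⟨k, -, rfl⟩ := Finset.mem_map.mp hi
    have hsk : (s k) ≠ 0 := hsli.ne_zero k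
    have := hmatch (e (Sum.inl k)) (s k * x)
      (hST (Submodule.mul_mem_mul (finBasis K S k).2 hx))
    simp only [Function.comp_apply, Equiv.symm_apply_apply, Sum.elim_inl,
      inv_mul_cancel_left₀ hsk] at this
    exact this (hT hx))
  omega

/-- The dimension bound for products landing in `A` suffices for being matched. -/
theorem isMatchedTo_of_finrank_add_finrank_le {K L : Type*} [Field K] [Field L] [Algebra K L]
    {A B : Submodule K L} [FiniteDimensional K B] (hAB : finrank K A = finrank K B)
    (h : ∀ S T : Submodule K L, S ≠ ⊥ → S ≤ A → T ≤ B → S * T ≤ A →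
      finrank K S + finrank K T ≤ finrank K B) :
    IsMatchedTo A B := by
  intro n a ha haA
  have hcard : Fintype.card (Fin n) = finrank K B := by
    rw [← hAB, ← haA, finrank_span_eq_card ha]
  obtain ⟨b, hb⟩ := exists_basis_forall_repr_eq_zero hcard
    (fun i => (A.comap (LinearMap.mulLeft K (a i))).comap B.subtype) (by
      intro J
      obtain rfl | ⟨i₀, hi₀⟩ := J.eq_empty_or_nonempty
      · exact Submodule.finrank_le _
      set U := J.inf fun i => (A.comap (LinearMap.mulLeft K (a i))).comap B.subtype with hU
      have hmem := h (Submodule.span K (a '' J)) (U.map B.subtype)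
        (by
          rw [Submodule.ne_bot_iff]
          exact ⟨a i₀, Submodule.subset_span ⟨i₀, hi₀, rfl⟩, ha.ne_zero i₀⟩)
        (by
          rw [← haA]
          exact Submodule.span_mono (Set.image_subset_range _ _))
        (Submodule.map_subtype_le B U)
        (by
          rw [← Submodule.span_eq (U.map B.subtype), Submodule.span_mul_span, Submodule.span_le]
          rintro _ ⟨_, ⟨i, hi, rfl⟩, _, ⟨y, hy, rfl⟩, rfl⟩
          have hle : U ≤ (A.comap (LinearMap.mulLeft K (a i))).comap B.subtype := Finset.inf_le hi
          exact hle hy)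
      have h1 : finrank K ↥(U.map B.subtype) = finrank K U :=
        (Submodule.equivMapOfInjective _ B.injective_subtype U).finrank_eq.symm
      have h2 : finrank K ↥(Submodule.span K (a '' J)) = J.card := by
        have := finrank_span_eq_card (ha.comp (Subtype.val : J → Fin n) Subtype.val_injective)
        rw [Set.range_comp, Subtype.range_coe_subtype] at this
        simpa using this
      omega)
  refine ⟨fun i => b i, b.linearIndependent.map' B.subtype B.ker_subtype, ?_, ?_⟩
  · have : (Set.range fun i => (b i : L)) = B.subtype '' Set.range b := by
      rw [← Set.range_comp]
      rfl
    rw [this, Submodule.span_image, b.span_eq, Submodule.map_subtype_top]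
  · intro i x hx hxB
    have hrepr := hb i ⟨(a i)⁻¹ * x, hxB⟩ (by
      simpa [mul_inv_cancel_left₀ (ha.ne_zero i)] using hx)
    have himage : (fun i => (b i : L)) '' {j | j ≠ i} = B.subtype '' (b '' {j | j ≠ i}) := by
      rw [← Set.image_comp]
      rfl
    rw [himage, Submodule.span_image]
    refine ⟨⟨(a i)⁻¹ * x, hxB⟩, b.mem_span_image.mpr fun j hj => ?_, rfl⟩
    rintro rfl
    exact Finsupp.mem_support_iff.mp hj hrepr

/-- Characterization of matchable subspaces via the linear Dyson transform:
`A` is matched to `B` iff for all nonzero subspaces `S ⊆ A` and `R ⊆ B ⊕ K` with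
`⟨SR⟩ = S` one has `dim S ≤ dim B - dim (R ∩ B)`. -/
theorem stmt_11 {K L : Type*} [Field K] [Field L] [Algebra K L]
    (hKL : ∃ x : L, x ∉ Set.range (algebraMap K L))
    (A B : Submodule K L) (n : ℕ) (hn : 0 < n)
    (hA : Module.finrank K A = n) (hB : Module.finrank K B = n)
    (h1 : (1 : L) ∉ B) :
    IsMatchedTo A B ↔
      ∀ S R : Submodule K L, S ≠ ⊥ → R ≠ ⊥ → S ≤ A →
        R ≤ B ⊔ Submodule.span K {(1 : L)} →
        Submodule.span K ((S : Set L) * (R : Set L)) = S →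
        Module.finrank K ↥S ≤ Module.finrank K ↥B - Module.finrank K ↥(R ⊓ B) := by
  have : FiniteDimensional K A := Module.finite_of_finrank_pos (hA ▸ hn)
  have : FiniteDimensional K B := Module.finite_of_finrank_pos (hB ▸ hn)
  constructor
  · intro h S R _ _ hSA _ hSR
    rw [← Submodule.mul_eq_span_mul_set] at hSR
    have := h.finrank_add_finrank_le hSA (inf_le_right : R ⊓ B ≤ B)
      ((mul_le_mul_right inf_le_left S).trans (hSR.le.trans hSA))
    omega
  · intro h
    refine isMatchedTo_of_finrank_add_finrank_le (hA.trans hB.symm) fun S T hS hSA hTB hST => ?_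
    have : FiniteDimensional K S := Submodule.finiteDimensional_of_le hSA
    have : FiniteDimensional K T := Submodule.finiteDimensional_of_le hTB
    have hone : (1 : L) ∈ T ⊔ K ∙ (1 : L) :=
      Submodule.mem_sup_right (Submodule.mem_span_singleton_self 1)
    obtain ⟨S', R', hSS', hS', hR', hR'1, hmul, hfin⟩ :=
      exists_mul_eq_left_of_one_mem S (T ⊔ K ∙ (1 : L)) hone
    have hRB : R' ≤ B ⊔ K ∙ (1 : L) := hR'.trans (sup_le_sup_right hTB _)
    have hSA' : S' ≤ A := by
      refine hS'.trans ?_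
      rw [Submodule.mul_sup, ← Submodule.one_eq_span, mul_one]
      exact sup_le hST hSA
    have hbound := h S' R' (ne_bot_of_le_ne_bot hS hSS')
      (Submodule.ne_bot_iff _ |>.mpr ⟨1, hR'1, one_ne_zero⟩) hSA' hRB
      (by rw [← Submodule.mul_eq_span_mul_set, hmul])
    have hsplit : R' ⊓ B ⊔ K ∙ (1 : L) = R' := by
      have hle : K ∙ (1 : L) ≤ R' := by simpa using hR'1
      rw [inf_sup_assoc_of_le B hle]
      exact inf_eq_left.mpr hRB
    have finrank_sup_one (W : Submodule K L) (hW : W ≤ B) :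
        finrank K ↥(W ⊔ K ∙ (1 : L)) = finrank K W + 1 := by
      have : FiniteDimensional K W := Submodule.finiteDimensional_of_le hW
      have hdisj : Disjoint W (K ∙ (1 : L)) := by
        rw [Submodule.disjoint_span_singleton' one_ne_zero]
        exact fun h => h1 (hW h)
      have := Submodule.finrank_sup_add_finrank_inf_eq W (K ∙ (1 : L))
      rwa [hdisj.eq_bot, finrank_bot, add_zero, finrank_span_singleton one_ne_zero] at this
    have hd1 := finrank_sup_one T hTB
    have hd2 := finrank_sup_one (R' ⊓ B) inf_le_right
    rw [hsplit] at hd2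
    have hpos : 0 < finrank K S := Nat.pos_of_ne_zero (mt Submodule.finrank_eq_zero.mp hS)
    have hle : finrank K S ≤ finrank K S' := by
      have : FiniteDimensional K S' := Submodule.finiteDimensional_of_le hSA'
      exact Submodule.finrank_mono hSS'
    omega
end

section
/- Let K ⊆ L be a field extension, let n be a positive integer, let S and R be nonzero K-subspaces of L, and let x ∈ R. Assume that ⟨SR⟩ = S and dim S ≤ n. Then x is algebraic over K with [K(x) : K] ≤ n, and for each a ∈ S we have aK(x) ⊆ S. -/
open Pointwise

/-- If `S`, `R` are nonzero `K`-subspaces of `L`, `x ∈ R`, `⟨SR⟩ = S` and `dim S ≤ n`,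
then `x` is algebraic over `K` with `[K(x) : K] ≤ n`, and `a K(x) ⊆ S` for every
`a ∈ S`. -/
theorem stmt_12 {K L : Type*} [Field K] [Field L] [Algebra K L]
    (n : ℕ) (hn : 0 < n) (S R : Submodule K L) (hS : S ≠ ⊥) (hR : R ≠ ⊥)
    (x : L) (hx : x ∈ R)
    (hSR : Submodule.span K ((S : Set L) * (R : Set L)) = S)
    (hdim : Module.rank K ↥S ≤ (n : Cardinal)) :
    IsAlgebraic K x ∧
      Module.finrank K (IntermediateField.adjoin K {x}) ≤ n ∧
      ∀ a ∈ S, ∀ y ∈ IntermediateField.adjoin K {x}, a * y ∈ S := by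
  have hmul : ∀ a ∈ S, a * x ∈ S := fun a ha =>
    hSR.le (Submodule.subset_span (Set.mul_mem_mul ha hx))
  have hfin : Module.Finite K S :=
    Module.rank_lt_aleph0_iff.mp (hdim.trans_lt Cardinal.natCast_lt_aleph0)
  have hint : IsIntegral K x :=
    isIntegral_of_smul_mem_submodule (M := L) S hS (Module.Finite.iff_fg.mp hfin) x
      fun a ha => by simpa [mul_comm] using hmul a ha
  have hadj : ∀ y ∈ IntermediateField.adjoin K {x}, ∀ a ∈ S, a * y ∈ S := by
    intro y hy
    rw [← IntermediateField.mem_toSubalgebra,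
      IntermediateField.adjoin_simple_toSubalgebra_of_isAlgebraic hint.isAlgebraic] at hy
    induction hy using Algebra.adjoin_induction with
    | mem y hy =>
      rw [Set.mem_singleton_iff.mp hy]
      exact hmul
    | algebraMap r =>
      intro a ha
      rw [mul_comm, ← Algebra.smul_def]
      exact S.smul_mem r ha
    | add y z _ _ ihy ihz =>
      intro a ha
      rw [mul_add]
      exact S.add_mem (ihy a ha) (ihz a ha)
    | mul y z _ _ ihy ihz =>
      intro a ha
      rw [← mul_assoc]
      exact ihz _ (ihy a ha)
  refine ⟨hint.isAlgebraic, ?_, fun a ha y hy => hadj y hy a ha⟩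
  obtain ⟨a, ha, ha0⟩ := S.exists_mem_ne_zero_of_ne_bot hS
  let f : IntermediateField.adjoin K {x} →ₗ[K] S :=
    ((LinearMap.mulLeft K a).comp (IntermediateField.adjoin K {x}).val.toLinearMap).codRestrict S
      fun y => hadj y y.2 a ha
  have hf : Function.Injective f := fun y z hyz =>
    Subtype.ext (mul_left_cancel₀ ha0 (congrArg Subtype.val hyz))
  exact (LinearMap.finrank_le_finrank_of_injective hf).trans
    (Module.finrank_le_of_rank_le hdim)
end

section
/- Let K ⊊ L be a field extension, and let A and B be two n-dimensional K-subspaces of L, with n > 0. Assume that B is a Chowla subspace of L. Then A is matched to B. -/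
open Module

/-- **Chowla's theorem** for subspaces of a field extension: the proof iterates the linear
Dyson transform `(S, U) ↦ (S + eU, U ∩ e⁻¹S)`. -/
theorem finrank_add_finrank_le_of_mul_le {K L : Type*} [Field K] [Field L] [Algebra K L]
    (A : Submodule K L) [FiniteDimensional K A] (S U : Submodule K L) [FiniteDimensional K U]
    (hS : S ≠ ⊥) (h1 : (1 : L) ∈ U) (hSU : S * U ≤ A)
    (hU : ∀ u ∈ U, u ∉ (1 : Submodule K L) → IsAlgebraic K u ∧
      finrank K A < finrank K (IntermediateField.adjoin K {u})) :
    finrank K S + finrank K U ≤ finrank K A + 1 := by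
  have hSA : S ≤ A := fun s hs => hSU (by simpa using Submodule.mul_mem_mul hs h1)
  have : FiniteDimensional K S := Submodule.finiteDimensional_of_le hSA
  by_cases hst : ∀ e ∈ S, ∀ u ∈ U, e * u ∈ S
  · have hU1 : U ≤ 1 := by
      intro u hu
      by_contra hu1
      obtain ⟨halg, hlt⟩ := hU u hu hu1
      obtain ⟨s, hs, hs0⟩ := Submodule.exists_mem_ne_zero_of_ne_bot hS
      have key : ∀ x ∈ IntermediateField.adjoin K {u}, ∀ t ∈ S, t * x ∈ S := by
        intro x hx
        rw [← IntermediateField.mem_toSubalgebra,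
          IntermediateField.adjoin_simple_toSubalgebra_of_isAlgebraic halg] at hx
        induction hx using Algebra.adjoin_induction with
        | mem x hx =>
          obtain rfl : x = u := hx
          exact fun t ht => hst t ht _ hu
        | algebraMap r =>
          intro t ht
          rw [mul_comm, ← Algebra.smul_def]
          exact S.smul_mem r ht
        | add x y _ _ hx hy =>
          intro t ht
          rw [mul_add]
          exact S.add_mem (hx t ht) (hy t ht)
        | mul x y _ _ hx hy =>
          intro t ht
          rw [← mul_assoc]
          exact hy _ (hx t ht)
      let g : IntermediateField.adjoin K {u} →ₗ[K] A :=
        ((LinearMap.mulLeft K s).comp (IntermediateField.val _).toLinearMap).codRestrict A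
          fun x => hSA (key x.1 x.2 s hs)
      have hg : Function.Injective g := by
        intro x y hxy
        exact Subtype.ext (mul_left_cancel₀ hs0 (congrArg Subtype.val hxy))
      exact absurd (LinearMap.finrank_le_finrank_of_injective hg) (not_le.2 hlt)
    have hfin : FiniteDimensional K (1 : Submodule K L) := by
      rw [Submodule.one_eq_span]; infer_instance
    have h1' : finrank K (1 : Submodule K L) = 1 := by
      rw [Submodule.one_eq_span, finrank_span_singleton one_ne_zero]
    have := Submodule.finrank_mono hU1
    have := Submodule.finrank_mono hSA
    omega
  · push Not at hst
    obtain ⟨e, he, u, hu, heu⟩ := hst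
    have he0 : e ≠ 0 := by
      rintro rfl
      simp at heu
    let m := LinearMap.mulLeft K e
    have hm : Function.Injective m := fun x y hxy => mul_left_cancel₀ he0 hxy
    have hlt : U ⊓ S.comap m < U :=
      lt_of_le_of_ne inf_le_left fun h => heu ((h.ge hu).2)
    have hfin : FiniteDimensional K ↥(U ⊓ S.comap m) :=
      Submodule.finiteDimensional_of_le inf_le_left
    have hdec : finrank K ↥(U ⊓ S.comap m) < finrank K U := Submodule.finrank_lt_finrank_of_lt hlt
    have ih := finrank_add_finrank_le_of_mul_le A (S ⊔ U.map m) (U ⊓ S.comap m)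
      (ne_bot_of_le_ne_bot hS le_sup_left) ⟨h1, by simpa [m] using he⟩
      (by
        rw [Submodule.sup_mul, sup_le_iff]
        refine ⟨(mul_le_mul_right inf_le_left S).trans hSU, Submodule.mul_le.2 ?_⟩
        rintro _ ⟨x, hx, rfl⟩ y ⟨-, hy⟩
        have : m x * y = m y * x := by simp only [m, LinearMap.mulLeft_apply]; ring
        rw [this]
        exact hSU (Submodule.mul_mem_mul hy hx))
      fun v hv => hU v hv.1
    have hdim := Submodule.finrank_sup_add_finrank_inf_eq S (U.map m)
    have hmap : finrank K (U.map m) = finrank K U := (U.equivMapOfInjective m hm).finrank_eq.symm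
    have hinf : finrank K ↥(S ⊓ U.map m) = finrank K ↥(U ⊓ S.comap m) := by
      have hmi : (U ⊓ S.comap m).map m = S ⊓ U.map m := by
        rw [inf_comm S]
        exact SetLike.coe_injective (Set.image_inter_preimage m U S)
      rw [← hmi]
      exact ((U ⊓ S.comap m).equivMapOfInjective m hm).finrank_eq.symm
    omega
termination_by finrank K U

/-- **Rado's theorem** for families of subspaces: a family satisfying the dimension form of Hall's
condition has a linearly independent transversal. -/
theorem exists_linearIndependent_of_card_le_finrank {K V ι : Type*} [Field K] [AddCommGroup V]
    [Module K V] [FiniteDimensional K V] [Fintype ι] [DecidableEq ι] (U : ι → Submodule K V)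
    (h : ∀ J : Finset ι, J.card ≤ finrank K ↥(J.sup U)) :
    ∃ u : ι → V, (∀ i, u i ∈ U i) ∧ LinearIndependent K u := by
  by_cases hone : ∀ i, finrank K (U i) ≤ 1
  · have hgen : ∀ i, ∃ v : V, U i = Submodule.span K {v} := by
      intro i
      obtain ⟨v, hv⟩ := finrank_le_one_iff.1 (hone i)
      refine ⟨v, le_antisymm (fun x hx => ?_) ?_⟩
      · obtain ⟨c, hc⟩ := hv ⟨x, hx⟩
        exact Submodule.mem_span_singleton.2 ⟨c, congrArg Subtype.val hc⟩
      · exact (Submodule.span_singleton_le_iff_mem _ _).2 v.2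
    choose u hu using hgen
    refine ⟨u, fun i => hu i ▸ Submodule.mem_span_singleton_self _, ?_⟩
    rw [linearIndependent_iff_card_le_finrank_span]
    have hsup : Finset.univ.sup U = Submodule.span K (Set.range u) := by
      rw [Finset.sup_univ_eq_iSup, Submodule.span_range_eq_iSup]
      exact iSup_congr hu
    have := h Finset.univ
    rwa [hsup] at this
  · push Not at hone
    obtain ⟨i, hi⟩ := hone
    have hbot : U i ≠ ⊥ := by
      intro hb
      rw [hb, finrank_bot] at hi
      omega
    obtain ⟨x, hx, hx0⟩ := Submodule.exists_mem_ne_zero_of_ne_bot hbot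
    obtain ⟨C, hC⟩ := exists_isCompl (Submodule.span K {x})
    have hxU : Submodule.span K {x} ≤ U i := (Submodule.span_singleton_le_iff_mem _ _).2 hx
    have hlt₁ : Submodule.span K {x} < U i := by
      refine lt_of_le_of_ne hxU fun hE => ?_
      rw [← hE, finrank_span_singleton hx0] at hi
      omega
    have hlt₂ : C ⊓ U i < U i := by
      refine lt_of_le_of_ne inf_le_right fun hE => hx0 ?_
      exact Submodule.disjoint_def.1 hC.disjoint x (Submodule.mem_span_singleton_self x)
        (hE.ge hx).1
    have hsup : Submodule.span K {x} ⊔ C ⊓ U i = U i := by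
      rw [← sup_inf_assoc_of_le _ hxU, hC.sup_eq_top, top_inf_eq]
    have step : ∀ H < U i,
        (∀ J : Finset ι, J.card ≤ finrank K ↥(J.sup (Function.update U i H))) →
        ∃ u : ι → V, (∀ j, u j ∈ U j) ∧ LinearIndependent K u := by
      intro H hH hJ
      have hle : ∀ j, Function.update U i H j ≤ U j := by
        intro j
        rcases eq_or_ne j i with rfl | hj
        · simpa using hH.le
        · simp [hj]
      have hdec : ∑ j, finrank K ↥(Function.update U i H j) < ∑ j, finrank K ↥(U j) :=
        Finset.sum_lt_sum (fun j _ => Submodule.finrank_mono (hle j))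
          ⟨i, Finset.mem_univ i, by
            rw [Function.update_self]
            exact Submodule.finrank_lt_finrank_of_lt hH⟩
      obtain ⟨u, hu, hli⟩ := exists_linearIndependent_of_card_le_finrank _ hJ
      exact ⟨u, fun j => hle j (hu j), hli⟩
    have fail : ∀ H : Submodule K V,
        (¬ ∀ J : Finset ι, J.card ≤ finrank K ↥(J.sup (Function.update U i H))) →
        ∃ J : Finset ι, i ∉ J ∧ finrank K ↥(H ⊔ J.sup U) ≤ J.card := by
      intro H hH
      push Not at hH
      obtain ⟨J, hJ⟩ := hH
      have hcongr : ∀ T : Finset ι, i ∉ T → T.sup (Function.update U i H) = T.sup U :=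
        fun T hT => Finset.sup_congr rfl fun j hj =>
          Function.update_of_ne (ne_of_mem_of_not_mem hj hT) _ _
      have hiJ : i ∈ J := by
        by_contra hiJ
        rw [hcongr J hiJ] at hJ
        exact absurd (h J) (not_le.2 hJ)
      refine ⟨J.erase i, Finset.notMem_erase i J, ?_⟩
      rw [← Finset.insert_erase hiJ, Finset.sup_insert, Function.update_self,
        hcongr _ (Finset.notMem_erase i J),
        Finset.card_insert_of_notMem (Finset.notMem_erase i J)] at hJ
      omega
    by_cases h₁ : ∀ J : Finset ι,
        J.card ≤ finrank K ↥(J.sup (Function.update U i (Submodule.span K {x})))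
    · exact step _ hlt₁ h₁
    by_cases h₂ : ∀ J : Finset ι, J.card ≤ finrank K ↥(J.sup (Function.update U i (C ⊓ U i)))
    · exact step _ hlt₂ h₂
    obtain ⟨J₁, hi₁, hJ₁⟩ := fail _ h₁
    obtain ⟨J₂, hi₂, hJ₂⟩ := fail _ h₂
    have hdim := Submodule.finrank_sup_add_finrank_inf_eq
      (Submodule.span K {x} ⊔ J₁.sup U) (C ⊓ U i ⊔ J₂.sup U)
    have hunion : (Submodule.span K {x} ⊔ J₁.sup U) ⊔ (C ⊓ U i ⊔ J₂.sup U) =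
        (insert i (J₁ ∪ J₂)).sup U := by
      rw [Finset.sup_insert, Finset.sup_union, sup_sup_sup_comm, hsup]
    have hinter : (J₁ ∩ J₂).sup U ≤
        (Submodule.span K {x} ⊔ J₁.sup U) ⊓ (C ⊓ U i ⊔ J₂.sup U) :=
      le_inf ((Finset.sup_mono Finset.inter_subset_left).trans le_sup_right)
        ((Finset.sup_mono Finset.inter_subset_right).trans le_sup_right)
    have hu := h (insert i (J₁ ∪ J₂))
    rw [← hunion, Finset.card_insert_of_notMem (by simp [hi₁, hi₂])] at hu
    have hn := (h (J₁ ∩ J₂)).trans (Submodule.finrank_mono hinter)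
    have := Finset.card_union_add_card_inter J₁ J₂
    omega
termination_by ∑ i, finrank K (U i)

/-- A family of subspaces indexed by a set of size `dim V` is contained in the coordinate
hyperplanes of some basis as soon as its intersections are small enough. -/
theorem exists_basis_le_span_image_ne {K V ι : Type*} [Field K] [AddCommGroup V]
    [Module K V] [FiniteDimensional K V] [Fintype ι] [DecidableEq ι]
    (hι : Fintype.card ι = finrank K V) (W : ι → Submodule K V)
    (h : ∀ J : Finset ι, J.card + finrank K ↥(J.inf W) ≤ finrank K V) :
    ∃ c : Basis ι K V, ∀ i, W i ≤ Submodule.span K (c '' {j | j ≠ i}) := by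
  have hann : ∀ J : Finset ι,
      J.sup (fun i => (W i).dualAnnihilator) = (J.inf W).dualAnnihilator := by
    intro J
    induction J using Finset.induction_on with
    | empty => simp
    | insert i J _ ih =>
      rw [Finset.sup_insert, Finset.inf_insert, ih, Subspace.dualAnnihilator_inf_eq]
  obtain ⟨f, hf, hli⟩ := exists_linearIndependent_of_card_le_finrank
    (fun i => (W i).dualAnnihilator) (by
      intro J
      rw [hann]
      have := Subspace.finrank_add_finrank_dualAnnihilator_eq (J.inf W)
      have := h J
      omega)
  rcases isEmpty_or_nonempty ι with hE | hE
  · exact ⟨basisOfFinrankZero (by rw [← hι, Fintype.card_eq_zero]), isEmptyElim⟩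
  let fb : Basis ι K (Dual K V) := basisOfLinearIndependentOfCardEqFinrank hli
    (by rw [hι, Subspace.dual_finrank_eq])
  let c : Basis ι K V := fb.dualBasis.map (evalEquiv K V).symm
  have hfc : ∀ i x, c.repr x i = f i x := by
    intro i x
    simp [c, fb]
  refine ⟨c, fun i x hx => ?_⟩
  rw [← c.sum_repr x]
  refine Submodule.sum_mem _ fun j _ => ?_
  rcases eq_or_ne j i with rfl | hj
  · rw [hfc, (Submodule.mem_dualAnnihilator _).1 (hf j) x hx, zero_smul]
    exact Submodule.zero_mem _
  · exact Submodule.smul_mem _ _ (Submodule.subset_span ⟨j, hj, rfl⟩)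


/-- If `B` is a Chowla subspace (every nonzero `b ∈ B` is algebraic over `K` with
`[K(b) : K] ≥ dim B + 1`), then `A` is matched to `B`. -/
theorem stmt_13 {K L : Type*} [Field K] [Field L] [Algebra K L]
    (hKL : ∃ x : L, x ∉ Set.range (algebraMap K L))
    (A B : Submodule K L) (n : ℕ) (hn : 0 < n)
    (hA : Module.finrank K A = n) (hB : Module.finrank K B = n)
    (hChowla : ∀ b ∈ B, b ≠ (0 : L) → IsAlgebraic K b ∧
      Module.finrank K ↥B + 1 ≤ Module.finrank K (IntermediateField.adjoin K {b})) :
    IsMatchedTo A B := by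
  intro m a ha hspan
  have : FiniteDimensional K A := Module.finite_of_finrank_pos (hA ▸ hn)
  have : FiniteDimensional K B := Module.finite_of_finrank_pos (hB ▸ hn)
  have hm : m = n := by
    rw [← hA, ← hspan, finrank_span_eq_card ha, Fintype.card_fin]
  let W : Fin m → Submodule K B := fun i =>
    (A.comap (LinearMap.mulLeft K (a i))).comap B.subtype
  have hdeg : ∀ u ∈ B, u ≠ 0 → u ∉ (1 : Submodule K L) := by
    intro u hu hu0 hu1
    obtain ⟨r, rfl⟩ := Submodule.mem_one.1 hu1
    have h2 := (hChowla _ hu hu0).2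
    have hbot : IntermediateField.adjoin K {algebraMap K L r} = ⊥ :=
      IntermediateField.adjoin_simple_eq_bot_iff.2 (IntermediateField.algebraMap_mem _ r)
    rw [hbot, IntermediateField.finrank_bot] at h2
    omega
  have hW : ∀ J : Finset (Fin m), J.card + finrank K ↥(J.inf W) ≤ finrank K B := by
    intro J
    rcases J.eq_empty_or_nonempty with rfl | ⟨i₀, hi₀⟩
    · rw [Finset.card_empty, zero_add]
      exact Submodule.finrank_le _
    let S := Submodule.span K (Set.range fun i : J => a i)
    let T := (J.inf W).map B.subtype
    have hTB : T ≤ B := Submodule.map_subtype_le B _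
    have hScard : finrank K S = J.card := by
      exact (finrank_span_eq_card (ha.comp _ Subtype.val_injective)).trans (Fintype.card_coe J)
    have hSbot : S ≠ ⊥ := by
      intro hb
      rw [hb, finrank_bot] at hScard
      exact absurd hScard.symm (Finset.card_ne_zero_of_mem hi₀)
    have hT : finrank K T = finrank K ↥(J.inf W) :=
      Submodule.finrank_map_subtype_eq B _
    have hfin : FiniteDimensional K (1 : Submodule K L) := by
      rw [Submodule.one_eq_span]; infer_instance
    have hone : finrank K (1 : Submodule K L) = 1 := by
      rw [Submodule.one_eq_span, finrank_span_singleton one_ne_zero]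
    have hinf : (1 : Submodule K L) ⊓ T = ⊥ := by
      rw [eq_bot_iff]
      rintro x ⟨hx1, hxT⟩
      by_contra hx0
      exact hdeg x (hTB hxT) hx0 hx1
    have hSA : S ≤ A := by
      rw [← hspan]
      apply Submodule.span_mono
      rintro _ ⟨i, rfl⟩
      exact ⟨i, rfl⟩
    have hST : S * T ≤ A := by
      rw [Submodule.mul_le]
      rintro s hs _ ⟨t, ht, rfl⟩
      have hle : S ≤ A.comap (LinearMap.mulRight K (t : L)) := by
        rw [Submodule.span_le]
        rintro _ ⟨i, rfl⟩
        exact (Finset.inf_le i.2 : J.inf W ≤ W i) ht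
      exact hle hs
    have key := finrank_add_finrank_le_of_mul_le A S (1 ⊔ T) hSbot
      ((le_sup_left : (1 : Submodule K L) ≤ 1 ⊔ T) (Submodule.one_le.1 le_rfl))
      (by
        rw [Submodule.mul_sup, mul_one]
        exact sup_le hSA hST)
      (by
        intro u hu hu1
        obtain ⟨y, hy, t, ht, rfl⟩ := Submodule.mem_sup.1 hu
        have ht0 : t ≠ 0 := by
          rintro rfl
          exact hu1 (by simpa using hy)
        obtain ⟨r, rfl⟩ := Submodule.mem_one.1 hy
        obtain ⟨halg, hlt⟩ := hChowla t (hTB ht) ht0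
        refine ⟨(isAlgebraic_algebraMap r).add halg, ?_⟩
        have hadj : IntermediateField.adjoin K {algebraMap K L r + t} =
            IntermediateField.adjoin K {t} := by
          apply le_antisymm
          · rw [IntermediateField.adjoin_simple_le_iff]
            exact add_mem (IntermediateField.algebraMap_mem _ r)
              (IntermediateField.mem_adjoin_simple_self K t)
          · rw [IntermediateField.adjoin_simple_le_iff]
            have := sub_mem (IntermediateField.mem_adjoin_simple_self K (algebraMap K L r + t))
              (IntermediateField.algebraMap_mem _ r)
            rwa [add_sub_cancel_left] at this
        rw [hadj]
        omega)
    have hdim := Submodule.finrank_sup_add_finrank_inf_eq (1 : Submodule K L) T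
    rw [hinf, finrank_bot] at hdim
    omega
  obtain ⟨c, hc⟩ := exists_basis_le_span_image_ne (by simp [hm, hB]) W hW
  refine ⟨fun i => c i, c.linearIndependent.map' B.subtype B.ker_subtype, ?_, ?_⟩
  · have : Set.range (fun i => (c i : L)) = B.subtype '' Set.range c := by
      rw [← Set.range_comp]; rfl
    rw [this, Submodule.span_image, c.span_eq, Submodule.map_subtype_top]
  · intro i x hx hxB
    have hmem : (⟨(a i)⁻¹ * x, hxB⟩ : B) ∈ W i := by
      change a i * ((a i)⁻¹ * x) ∈ A
      rwa [mul_inv_cancel_left₀ (ha.ne_zero i)]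
    have := Submodule.mem_map_of_mem (f := B.subtype) (hc i hmem)
    rw [← Submodule.span_image, Set.image_image] at this
    exact this
end

section
/- Let K ⊊ L be a field extension, and let A be a nonzero finite-dimensional K-subspace of L. Then A is matched to itself if and only if 1 ∉ A. -/
open Module

theorem finrank_map_of_injective {K V W : Type*} [Field K] [AddCommGroup V] [Module K V]
    [AddCommGroup W] [Module K W] {f : V →ₗ[K] W} (hf : Function.Injective f)
    (S : Submodule K V) : finrank K (S.map f) = finrank K S :=
  (Submodule.equivMapOfInjective f hf S).finrank_eq.symm

/-- **Rado's theorem** for families of subspaces: a linearly independent transversal exists as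
soon as any `m` of the subspaces span a space of dimension at least `m`. -/
theorem exists_linearIndependent_mem_of_card_le_finrank_iSup {K V ι : Type*} [Field K]
    [AddCommGroup V] [Module K V] [FiniteDimensional K V] [Fintype ι]
    (S : ι → Submodule K V)
    (hS : ∀ J : Finset ι, J.card ≤ finrank K (⨆ i ∈ J, S i : Submodule K V)) :
    ∃ v : ι → V, (∀ i, v i ∈ S i) ∧ LinearIndependent K v := by
  classical
  induction hN : ∑ i, finrank K (S i) using Nat.strong_induction_on generalizing S with
  | _ N ih =>
  by_cases hdim : ∀ i, finrank K (S i) ≤ 1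
  · have hne (i : ι) : ∃ v : V, S i = K ∙ v := by
      obtain ⟨v, hv⟩ := finrank_le_one_iff.mp (hdim i)
      refine ⟨v, le_antisymm (fun x hx => ?_) ?_⟩
      · obtain ⟨c, hc⟩ := hv ⟨x, hx⟩
        exact Submodule.mem_span_singleton.mpr ⟨c, congrArg Subtype.val hc⟩
      · exact (Submodule.span_singleton_le_iff_mem _ _).mpr v.2
    choose v hv using hne
    refine ⟨v, fun i => hv i ▸ Submodule.mem_span_singleton_self _, ?_⟩
    rw [linearIndependent_iff_card_le_finrank_span, Set.finrank, Submodule.span_range_eq_iSup]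
    rw [show (⨆ i, K ∙ v i) = ⨆ i ∈ Finset.univ, S i by simp [hv]]
    exact hS Finset.univ
  · push Not at hdim
    obtain ⟨k, hk⟩ := hdim
    obtain ⟨P, Q, hP, hQ, hPQ⟩ : ∃ P Q : Submodule K V, P < S k ∧ Q < S k ∧ P ⊔ Q = S k := by
      obtain ⟨x, hx, hx0⟩ := (S k).ne_bot_iff.mp (by
        rintro h
        rw [h, finrank_bot] at hk
        omega)
      have hxS : K ∙ x ≤ S k := (Submodule.span_singleton_le_iff_mem _ _).mpr hx
      obtain ⟨Q, hQ⟩ := exists_isCompl (K ∙ x)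
      refine ⟨K ∙ x, Q ⊓ S k, lt_of_le_of_ne hxS fun h => ?_,
        lt_of_le_of_ne inf_le_right fun h => hx0 ?_, ?_⟩
      · rw [← h, finrank_span_singleton hx0] at hk
        omega
      · exact Submodule.disjoint_def.mp hQ.disjoint x (Submodule.mem_span_singleton_self x)
          (inf_eq_right.mp h hx)
      · rw [← sup_inf_assoc_of_le _ hxS, hQ.sup_eq_top, top_inf_eq]
    have descend (H : Submodule K V) (hH : H < S k) :
        (∃ v : ι → V, (∀ i, v i ∈ S i) ∧ LinearIndependent K v) ∨
          ∃ I : Finset ι, k ∉ I ∧ finrank K (H ⊔ ⨆ i ∈ I, S i : Submodule K V) ≤ I.card := by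
      have hle (i : ι) : Function.update S k H i ≤ S i := by
        obtain rfl | hi := eq_or_ne i k
        · simpa using hH.le
        · simp [hi]
      by_cases hall : ∀ J : Finset ι,
          J.card ≤ finrank K (⨆ i ∈ J, Function.update S k H i : Submodule K V)
      · left
        obtain ⟨v, hv, hvi⟩ := ih _ (by
          rw [← hN]
          refine Finset.sum_lt_sum (fun i _ => Submodule.finrank_mono (hle i))
            ⟨k, Finset.mem_univ k, ?_⟩
          rw [Function.update_self]
          exact Submodule.finrank_lt_finrank_of_lt hH) (Function.update S k H) hall rfl
        exact ⟨v, fun i => hle i (hv i), hvi⟩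
      · right
        push Not at hall
        obtain ⟨J, hJ⟩ := hall
        have hagree (I : Finset ι) (hI : k ∉ I) :
            (⨆ i ∈ I, Function.update S k H i) = ⨆ i ∈ I, S i := by
          refine biSup_congr fun i hi => ?_
          rw [Function.update_of_ne (ne_of_mem_of_not_mem hi hI)]
        have hkJ : k ∈ J := by
          by_contra h
          rw [hagree J h] at hJ
          exact (hS J).not_gt hJ
        refine ⟨J.erase k, Finset.notMem_erase k J, ?_⟩
        rw [← Finset.insert_erase hkJ, Finset.iSup_insert, hagree _ (Finset.notMem_erase k J),
          Function.update_self, Finset.card_insert_of_notMem (Finset.notMem_erase k J)] at hJ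
        omega
    obtain h | ⟨I, hkI, hI⟩ := descend P hP
    · exact h
    obtain h | ⟨I', hkI', hI'⟩ := descend Q hQ
    · exact h
    exfalso
    have hsup := (hS (insert k (I ∪ I'))).trans (Submodule.finrank_mono
      (show _ ≤ (P ⊔ ⨆ i ∈ I, S i) ⊔ (Q ⊔ ⨆ i ∈ I', S i) by
        rw [Finset.iSup_insert, Finset.iSup_union, ← hPQ, sup_sup_sup_comm]))
    have hinf := (hS (I ∩ I')).trans (Submodule.finrank_mono
      (show _ ≤ (P ⊔ ⨆ i ∈ I, S i) ⊓ (Q ⊔ ⨆ i ∈ I', S i) from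
        le_inf
          ((biSup_mono fun i hi => (Finset.mem_inter.mp hi).1).trans le_sup_right)
          ((biSup_mono fun i hi => (Finset.mem_inter.mp hi).2).trans le_sup_right)))
    rw [Finset.card_insert_of_notMem (by simp [hkI, hkI'])] at hsup
    have := Submodule.finrank_sup_add_finrank_inf_eq (P ⊔ ⨆ i ∈ I, S i) (Q ⊔ ⨆ i ∈ I', S i)
    have := Finset.card_union_add_card_inter I I'
    omega

/-- A linear analogue of the Kemperman-Scherk theorem, proved with the Dyson transform
`(X, Y) ↦ (X + eY, Y ∩ e⁻¹X)`, which preserves the multiplicativity of `f` on `X × Y`. -/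
theorem finrank_add_finrank_le_of_mul_le_s15 {K L : Type*} [Field K] [Field L] [Algebra K L]
    (f : L →ₗ[K] K) (hf : f 1 = 1) (M : Submodule K L) [FiniteDimensional K M]
    (X Y : Submodule K L) (hX : 1 ∈ X) (hY : 1 ∈ Y) (hXY : X * Y ≤ M)
    (hmul : ∀ x ∈ X, ∀ y ∈ Y, f (x * y) = f x * f y) :
    finrank K X + finrank K Y ≤ finrank K M + 1 := by
  have hYM : Y ≤ M := fun y hy => by simpa using hXY (Submodule.mul_mem_mul hX hy)
  have hXM : X ≤ M := fun x hx => by simpa using hXY (Submodule.mul_mem_mul hx hY)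
  have : FiniteDimensional K X := Submodule.finiteDimensional_of_le hXM
  have : FiniteDimensional K Y := Submodule.finiteDimensional_of_le hYM
  induction hN : finrank K Y using Nat.strong_induction_on generalizing X Y with
  | _ N ih =>
  by_cases hstab : ∀ e ∈ X, ∀ y ∈ Y, e * y ∈ X
  · suffices finrank K Y ≤ 1 by
      have := Submodule.finrank_mono hXM
      omega
    have hinj : ∀ y ∈ Y, f y = 0 → y = 0 := by
      intro y hy hfy
      by_contra hy0
      have hmap : X.map (LinearMap.mulLeft K y) = X := by
        refine Submodule.eq_of_le_of_finrank_eq ?_ ?_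
        · rintro _ ⟨x, hx, rfl⟩
          simpa [mul_comm] using hstab x hx y hy
        · exact finrank_map_of_injective (mul_right_injective₀ hy0) X
      obtain ⟨x, hx, hxy⟩ := hmap.ge hX
      have h := hmul x hx y hy
      rw [mul_comm, show y * x = 1 from hxy, hf, hfy, mul_zero] at h
      exact one_ne_zero h
    rw [← finrank_self K]
    refine LinearMap.finrank_le_finrank_of_injective (f := f.domRestrict Y) ?_
    rw [← LinearMap.ker_eq_bot, LinearMap.ker_eq_bot']
    exact fun y hy => Subtype.ext (hinj y y.2 hy)
  · push Not at hstab
    obtain ⟨e, he, y₀, hy₀, hey₀⟩ := hstab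
    have he0 : e ≠ 0 := by
      rintro rfl
      simp at hey₀
    let m := LinearMap.mulLeft K e
    have hm : Function.Injective m := mul_right_injective₀ he0
    have hsupinf := Submodule.finrank_sup_add_finrank_inf_eq X (Y.map m)
    have hinf : X ⊓ Y.map m = (Y ⊓ X.comap m).map m := by
      rw [Submodule.map_inf _ hm, Submodule.map_comap_eq, inf_comm, inf_comm (LinearMap.range m),
        ← inf_assoc, inf_eq_left.mpr (inf_le_left.trans LinearMap.map_le_range)]
    rw [hinf, finrank_map_of_injective hm, finrank_map_of_injective hm] at hsupinf
    have hlt : Y ⊓ X.comap m < Y :=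
      lt_of_le_of_ne inf_le_left fun h => hey₀ (inf_eq_left.mp h hy₀)
    have hfin := Submodule.finrank_lt_finrank_of_lt hlt
    have hXY' : (X ⊔ Y.map m) * (Y ⊓ X.comap m) ≤ M := by
      rw [Submodule.sup_mul, sup_le_iff]
      refine ⟨(mul_le_mul_right inf_le_left X).trans hXY, Submodule.mul_le.mpr ?_⟩
      rintro _ ⟨y, hy, rfl⟩ y' ⟨-, hy'⟩
      have := hXY (Submodule.mul_mem_mul hy' hy)
      convert this using 1
      simp only [m, LinearMap.mulLeft_apply]
      ring
    have := ih _ (hN ▸ hfin) (X ⊔ Y.map m) (Y ⊓ X.comap m) (Submodule.mem_sup_left hX)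
      ⟨hY, by simpa [m] using he⟩ hXY' (by
        intro z hz y' hy'
        obtain ⟨x, hx, _, ⟨y, hy, rfl⟩, rfl⟩ := Submodule.mem_sup.mp hz
        have h₁ := hmul x hx y' hy'.1
        have h₂ := hmul (e * y') hy'.2 y hy
        have h₃ := hmul e he y hy
        have h₄ := hmul e he y' hy'.1
        simp only [m, LinearMap.mulLeft_apply]
        rw [add_mul, map_add, map_add, h₁, mul_right_comm, h₂, h₃, h₄]
        ring) (fun y hy => hYM hy.1) (by
          refine sup_le hXM ?_
          rintro _ ⟨y, hy, rfl⟩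
          exact hXY (Submodule.mul_mem_mul he hy)) inferInstance inferInstance rfl
    omega

theorem finrank_span_singleton_sup {K V : Type*} [Field K] [AddCommGroup V] [Module K V]
    {v : V} {S : Submodule K V} [FiniteDimensional K S] (hv : v ∉ S) :
    finrank K ((K ∙ v) ⊔ S : Submodule K V) = finrank K S + 1 := by
  have hv0 : v ≠ 0 := fun h => hv (h ▸ S.zero_mem)
  have h := Submodule.finrank_sup_add_finrank_inf_eq (K ∙ v) S
  rw [((Submodule.disjoint_span_singleton' hv0).mpr hv).symm.eq_bot, finrank_bot,
    finrank_span_singleton hv0] at h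
  omega

theorem finrank_add_finrank_le_of_one_notMem {K L : Type*} [Field K] [Field L] [Algebra K L]
    {A U W : Submodule K L} [FiniteDimensional K A] (hA : (1 : L) ∉ A) (hU : U ≤ A)
    (hW : W ≤ A) (hUW : U * W ≤ A) : finrank K U + finrank K W ≤ finrank K A := by
  have : FiniteDimensional K U := Submodule.finiteDimensional_of_le hU
  have : FiniteDimensional K W := Submodule.finiteDimensional_of_le hW
  obtain ⟨g, hg1, hgA⟩ := Submodule.exists_le_ker_of_notMem hA
  let f : L →ₗ[K] K := (g 1)⁻¹ • g
  have hf1 : f 1 = 1 := inv_mul_cancel₀ hg1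
  have hfA (x : L) (hx : x ∈ A) : f x = 0 := by
    have : g x = 0 := hgA hx
    simp [f, this]
  have key := finrank_add_finrank_le_of_mul_le_s15 f hf1 ((K ∙ (1 : L)) ⊔ A) ((K ∙ (1 : L)) ⊔ U)
    ((K ∙ (1 : L)) ⊔ W) (Submodule.mem_sup_left (Submodule.mem_span_singleton_self 1))
    (Submodule.mem_sup_left (Submodule.mem_span_singleton_self 1)) (by
      rw [← Submodule.one_eq_span, Submodule.sup_mul, Submodule.mul_sup, one_mul, one_mul,
        Submodule.mul_sup, mul_one]
      exact sup_le (sup_le_sup_left hW 1)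
        (sup_le (hU.trans le_sup_right) (hUW.trans le_sup_right))) (by
      intro x hx y hy
      obtain ⟨_, hc, u, hu, rfl⟩ := Submodule.mem_sup.mp hx
      obtain ⟨c, rfl⟩ := Submodule.mem_span_singleton.mp hc
      obtain ⟨_, hd, w, hw, rfl⟩ := Submodule.mem_sup.mp hy
      obtain ⟨d, rfl⟩ := Submodule.mem_span_singleton.mp hd
      have huw := hfA _ (hUW (Submodule.mul_mem_mul hu hw))
      simp [mul_add, hf1, hfA u (hU hu), hfA w (hW hw), huw, mul_comm])
  rw [finrank_span_singleton_sup hA, finrank_span_singleton_sup fun h => hA (hU h),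
    finrank_span_singleton_sup fun h => hA (hW h)] at key
  omega

theorem exists_basis_le_span_compl_of_finrank_iInf_le {K E ι : Type*} [Field K] [AddCommGroup E]
    [Module K E] [FiniteDimensional K E] [Fintype ι] (C : ι → Submodule K E)
    (hcard : Fintype.card ι = finrank K E)
    (hC : ∀ J : Finset ι, J.card + finrank K (⨅ i ∈ J, C i : Submodule K E) ≤ finrank K E) :
    ∃ b : Basis ι K E, ∀ i, C i ≤ Submodule.span K (b '' {j | j ≠ i}) := by
  classical
  obtain ⟨φ, hφ, hli⟩ := exists_linearIndependent_mem_of_card_le_finrank_iSup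
    (fun i => (C i).dualAnnihilator) (fun J => by
      have h := Subspace.finrank_add_finrank_dualAnnihilator_eq (⨅ i ∈ J, C i)
      rw [show (⨅ i ∈ J, C i).dualAnnihilator = ⨆ i ∈ J, (C i).dualAnnihilator by
        rw [iInf_subtype', Subspace.dualAnnihilator_iInf_eq, iSup_subtype']] at h
      have := hC J
      omega)
  let β : Basis ι K (Dual K E) := Basis.mk hli
    (hli.span_eq_top_of_card_eq_finrank' (hcard.trans Subspace.dual_finrank_eq.symm)).ge
  let b : Basis ι K E := β.dualBasis.map (evalEquiv K E).symm
  refine ⟨b, fun i x hx => b.mem_span_image.mpr fun j hj => ?_⟩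
  rintro rfl
  refine Finsupp.mem_support_iff.mp hj ?_
  have hφx : φ j x = 0 := (Submodule.mem_dualAnnihilator _).mp (hφ j) x hx
  simpa [b, β] using hφx

theorem isMatchedTo_self_of_one_notMem {K L : Type*} [Field K] [Field L] [Algebra K L]
    {A : Submodule K L} [FiniteDimensional K A] (hA : (1 : L) ∉ A) : IsMatchedTo A A := by
  intro n a ha hspan
  have haA (i : Fin n) : a i ∈ A := hspan ▸ Submodule.subset_span (Set.mem_range_self i)
  let C (i : Fin n) : Submodule K A := (A.comap (LinearMap.mulLeft K (a i))).comap A.subtype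
  obtain ⟨b, hb⟩ := exists_basis_le_span_compl_of_finrank_iInf_le C
    (by rw [← finrank_span_eq_card ha, hspan]) (fun J => by
      have hU : finrank K (Submodule.span K (a '' J)) = J.card := by
        rw [Set.image_eq_range]
        exact (finrank_span_eq_card (ha.comp _ Subtype.val_injective)).trans (Fintype.card_coe J)
      rw [← hU, ← finrank_map_of_injective A.injective_subtype]
      refine finrank_add_finrank_le_of_one_notMem hA ?_ (A.map_subtype_le _) ?_
      · rw [Submodule.span_le]
        rintro _ ⟨i, -, rfl⟩
        exact haA i
      · rw [← Submodule.span_eq (Submodule.map _ _), Submodule.span_mul_span, Submodule.span_le]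
        rintro _ ⟨_, ⟨i, hi, rfl⟩, _, ⟨w, hw, rfl⟩, rfl⟩
        simp only [SetLike.mem_coe, Submodule.mem_iInf] at hw
        exact hw i hi)
  refine ⟨fun i => b i, b.linearIndependent.map' A.subtype A.ker_subtype, ?_, ?_⟩
  · rw [show (fun i => (b i : L)) = A.subtype ∘ b from rfl, Set.range_comp, ← Submodule.map_span,
      b.span_eq, Submodule.map_subtype_top]
  · intro i x hx hxA
    have hmem : (⟨(a i)⁻¹ * x, hxA⟩ : A) ∈ C i := by
      simpa [C, mul_inv_cancel_left₀ (ha.ne_zero i)] using hx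
    have := Submodule.mem_map_of_mem (f := A.subtype) (hb i hmem)
    rwa [Submodule.map_span, ← Set.image_comp] at this

theorem IsMatchedTo.one_notMem {K L : Type*} [Field K] [Field L] [Algebra K L]
    {A : Submodule K L} [FiniteDimensional K A] (h : IsMatchedTo A A) : (1 : L) ∉ A := by
  intro h1
  have hli : LinearIndepOn K id {(⟨1, h1⟩ : A)} :=
    LinearIndepOn.singleton (by simp [Subtype.ext_iff])
  let c := Basis.extend hli
  have hfin := FiniteDimensional.fintypeBasisIndex c
  let e := Fintype.equivFin (hli.extend (Set.subset_univ _))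
  let c' := c.reindex e
  obtain ⟨i, hi⟩ : ∃ i, c' i = ⟨1, h1⟩ :=
    ⟨e ⟨_, hli.subset_extend _ rfl⟩, by simp [c', c]⟩
  obtain ⟨b, hb, hbA, hmem⟩ := h _ (fun i => (c' i : L))
    (c'.linearIndependent.map' A.subtype A.ker_subtype)
    (by rw [show (fun i => (c' i : L)) = A.subtype ∘ c' from rfl, Set.range_comp,
      ← Submodule.map_span, c'.span_eq, Submodule.map_subtype_top])
  have hbi : b i ∈ A := hbA ▸ Submodule.subset_span (Set.mem_range_self i)
  have := hmem i (b i) hbi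
  simp only [hi, inv_one, one_mul] at this
  exact hb.notMem_span_image (s := {j | j ≠ i}) (by simp) (this hbi)

/-- A nonzero finite-dimensional `K`-subspace `A` of `L` is matched to itself
if and only if `1 ∉ A`. -/
theorem stmt_15 {K L : Type*} [Field K] [Field L] [Algebra K L]
    (hKL : ∃ x : L, x ∉ Set.range (algebraMap K L))
    (A : Submodule K L) (hA : A ≠ ⊥) (hfin : FiniteDimensional K A) :
    IsMatchedTo A A ↔ (1 : L) ∉ A := by
  exact ⟨IsMatchedTo.one_notMem, isMatchedTo_self_of_one_notMem⟩
end

section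
/- A field extension K ⊊ L has the linear matching property if and only if for every intermediate field F with K ⊆ F ⊆ L and [F : K] finite, either F = K or F = L. -/
open Module

/-- Rado theorem for subspaces: a linearly independent system of representatives. -/
theorem exists_linearIndependent_mem_of_card_le_finrank {K V ι : Type*} [Field K] [AddCommGroup V]
    [Module K V] [FiniteDimensional K V] [Fintype ι] [DecidableEq ι] (W : ι → Submodule K V)
    (hW : ∀ J : Finset ι, J.card ≤ finrank K ↥(J.sup W)) :
    ∃ w : ι → V, (∀ i, w i ∈ W i) ∧ LinearIndependent K w := by
  induction hm : ∑ i, finrank K (W i) using Nat.strong_induction_on generalizing W with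
  | _ m ih =>
  by_cases hone : ∀ i, finrank K (W i) ≤ 1
  · have hspan : ∀ i, ∃ x : V, Submodule.span K {x} = W i := by
      intro i
      obtain ⟨v, hv⟩ := finrank_le_one_iff.1 (hone i)
      refine ⟨v, le_antisymm (by simp) fun y hy => ?_⟩
      obtain ⟨c, hc⟩ := hv ⟨y, hy⟩
      exact Submodule.mem_span_singleton.2 ⟨c, congrArg Subtype.val hc⟩
    choose w hw using hspan
    refine ⟨w, fun i => hw i ▸ Submodule.mem_span_singleton_self _, ?_⟩
    rw [linearIndependent_iff_card_le_finrank_span]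
    have h := hW Finset.univ
    have e : Finset.univ.sup W = Submodule.span K (Set.range w) := by
      rw [Submodule.span_range_eq_iSup, Finset.sup_univ_eq_iSup]
      exact iSup_congr fun i => (hw i).symm
    rwa [e] at h
  · push Not at hone
    obtain ⟨i₀, hi₀⟩ := hone
    obtain ⟨x, hx, hx0⟩ : ∃ x ∈ W i₀, x ≠ 0 := by
      apply Submodule.exists_mem_ne_zero_of_ne_bot
      intro h
      rw [h, finrank_bot] at hi₀
      omega
    obtain ⟨C, hC⟩ := exists_isCompl (Submodule.span K {x})
    have hxW : Submodule.span K {x} ≤ W i₀ := by simpa using hx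
    have hU : Submodule.span K {x} < W i₀ := by
      refine lt_of_le_of_ne hxW fun h => ?_
      rw [← h, finrank_span_singleton hx0] at hi₀
      exact lt_irrefl _ hi₀
    have hU' : C ⊓ W i₀ < W i₀ := by
      refine lt_of_le_of_ne inf_le_right fun h => hx0 ?_
      have hxC : x ∈ C := (h.symm ▸ hx : x ∈ C ⊓ W i₀).1
      exact Submodule.disjoint_def.1 hC.disjoint x (Submodule.mem_span_singleton_self x) hxC
    have hsup : Submodule.span K {x} ⊔ (C ⊓ W i₀) = W i₀ := by
      rw [← sup_inf_assoc_of_le _ hxW, hC.sup_eq_top, top_inf_eq]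
    have shrink : ∀ U < W i₀,
        (∀ J : Finset ι, J.card ≤ finrank K ↥(J.sup (Function.update W i₀ U))) →
        ∃ w : ι → V, (∀ i, w i ∈ W i) ∧ LinearIndependent K w := by
      intro U hU hJ
      have hle : ∀ i, Function.update W i₀ U i ≤ W i := by
        intro i
        by_cases h : i = i₀
        · subst h
          rw [Function.update_self]
          exact hU.le
        · rw [Function.update_of_ne h]
      have hlt : ∑ i, finrank K ↥(Function.update W i₀ U i) < m := by
        rw [← hm]
        refine Finset.sum_lt_sum (fun i _ => Submodule.finrank_mono (hle i))
          ⟨i₀, Finset.mem_univ _, Submodule.finrank_lt_finrank_of_lt ?_⟩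
        rwa [Function.update_self]
      obtain ⟨w, hw, hli⟩ := ih _ hlt _ hJ rfl
      exact ⟨w, fun i => hle i (hw i), hli⟩
    have fail : ∀ U : Submodule K V,
        ¬ (∀ J : Finset ι, J.card ≤ finrank K ↥(J.sup (Function.update W i₀ U))) →
        ∃ P : Finset ι, i₀ ∉ P ∧ finrank K ↥(U ⊔ P.sup W) ≤ P.card := by
      intro U h
      push Not at h
      obtain ⟨J, hJ⟩ := h
      have hupd : ∀ P : Finset ι, i₀ ∉ P → P.sup (Function.update W i₀ U) = P.sup W := by
        intro P hP
        refine Finset.sup_congr rfl fun i hi => ?_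
        rw [Function.update_of_ne]
        rintro rfl
        exact hP hi
      by_cases hmem : i₀ ∈ J
      · refine ⟨J.erase i₀, Finset.notMem_erase _ _, ?_⟩
        rw [← Finset.insert_erase hmem, Finset.sup_insert, hupd _ (Finset.notMem_erase _ _),
          Function.update_self, Finset.card_insert_of_notMem (Finset.notMem_erase _ _)] at hJ
        omega
      · rw [hupd J hmem] at hJ
        exact absurd (hW J) (by omega)
    by_cases h1 : ∀ J : Finset ι,
        J.card ≤ finrank K ↥(J.sup (Function.update W i₀ (Submodule.span K {x})))
    · exact shrink _ hU h1
    by_cases h2 : ∀ J : Finset ι, J.card ≤ finrank K ↥(J.sup (Function.update W i₀ (C ⊓ W i₀)))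
    · exact shrink _ hU' h2
    exfalso
    obtain ⟨P, hP, hPc⟩ := fail _ h1
    obtain ⟨Q, hQ, hQc⟩ := fail _ h2
    have hmod := Submodule.finrank_sup_add_finrank_inf_eq
      (Submodule.span K {x} ⊔ P.sup W) ((C ⊓ W i₀) ⊔ Q.sup W)
    have e1 : (Submodule.span K {x} ⊔ P.sup W) ⊔ ((C ⊓ W i₀) ⊔ Q.sup W) =
        (insert i₀ (P ∪ Q)).sup W := by
      rw [sup_sup_sup_comm, hsup, Finset.sup_insert, Finset.sup_union]
    have e2 : (P ∩ Q).sup W ≤ (Submodule.span K {x} ⊔ P.sup W) ⊓ ((C ⊓ W i₀) ⊔ Q.sup W) :=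
      le_inf ((Finset.sup_mono Finset.inter_subset_left).trans le_sup_right)
        ((Finset.sup_mono Finset.inter_subset_right).trans le_sup_right)
    have c1 := hW (insert i₀ (P ∪ Q))
    have c2 := (hW (P ∩ Q)).trans (Submodule.finrank_mono e2)
    rw [Finset.card_insert_of_notMem (by simp [hP, hQ])] at c1
    rw [e1] at hmod
    have c3 := Finset.card_union_add_card_inter P Q
    omega

theorem finrank_span_singleton_mul {K L : Type*} [Field K] [Field L] [Algebra K L] {c : L}
    (hc : c ≠ 0) (X : Submodule K L) : finrank K ↥(Submodule.span K {c} * X) = finrank K X := by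
  have e : Submodule.span K {c} * X = X.map (LinearMap.mulLeft K c) := by
    ext x
    simp [Submodule.mem_span_singleton_mul]
  rw [e]
  exact (Submodule.equivMapOfInjective _ (mul_right_injective₀ hc) X).finrank_eq.symm

theorem span_singleton_inv_mul_span_singleton_mul {K L : Type*} [Field K] [Field L] [Algebra K L]
    {c : L} (hc : c ≠ 0) (X : Submodule K L) :
    Submodule.span K {c⁻¹} * (Submodule.span K {c} * X) = X := by
  rw [← mul_assoc, Submodule.span_mul_span, Set.singleton_mul_singleton, inv_mul_cancel₀ hc,
    ← Submodule.one_eq_span, one_mul]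

/-- The dual `Y = (X * V)ᗮ` of `X`, for a nondegenerate form `(x, y) ↦ τ (x * y)`. -/
theorem exists_finrank_dual_mul {K L : Type*} [Field K] [Field L] [Algebra K L]
    [FiniteDimensional K L] (X V : Submodule K L) :
    ∃ Y : Submodule K L, finrank K Y + finrank K ↥(X * V) = finrank K L ∧
      finrank K ↥(Y * V) + finrank K X ≤ finrank K L := by
  obtain ⟨τ, hτ⟩ := exists_ne (0 : Dual K L)
  obtain ⟨t, ht⟩ : ∃ t, τ t ≠ 0 := by
    by_contra! h
    exact hτ (LinearMap.ext h)
  let B : LinearMap.BilinForm K L := (LinearMap.mul K L).compr₂ τ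
  have hB : ∀ x y, B x y = τ (x * y) := fun _ _ => rfl
  have hker : LinearMap.ker B = ⊥ := by
    rw [LinearMap.ker_eq_bot']
    intro x hx
    by_contra hx0
    apply ht
    have := LinearMap.congr_fun hx (x⁻¹ * t)
    rwa [hB, mul_inv_cancel_left₀ hx0] at this
  have horth : ∀ W : Submodule K L,
      finrank K W + finrank K (B.orthogonal W) = finrank K L := by
    intro W
    have := LinearMap.BilinForm.finrank_add_finrank_orthogonal' (B := B) W
    rwa [hker, inf_bot_eq, finrank_bot, add_zero] at this
  refine ⟨B.orthogonal (X * V), by rw [add_comm, horth], ?_⟩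
  have hle : B.orthogonal (X * V) * V ≤ B.orthogonal X := by
    rw [Submodule.mul_le]
    intro y hy v hv
    rw [LinearMap.BilinForm.mem_orthogonal_iff] at hy ⊢
    intro x hx
    have := hy (x * v) (Submodule.mul_mem_mul hx hv)
    rw [hB] at this ⊢
    rw [← this]
    ring_nf
  have := Submodule.finrank_mono hle
  have := horth X
  omega

/-- A linear Cauchy–Davenport inequality, proved by the isoperimetric method: an atom containing `1`
is an intermediate field. -/
theorem finrank_add_finrank_le_finrank_mul_add_one {K L : Type*} [Field K] [Field L] [Algebra K L]
    (hF : ∀ F : IntermediateField K L, FiniteDimensional K F → F = ⊥ ∨ F = ⊤)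
    (U V : Submodule K L) [FiniteDimensional K U] [FiniteDimensional K V] (hU : U ≠ ⊥)
    (hV : (1 : L) ∈ V) (hUV : U * V ≠ ⊤) :
    finrank K U + finrank K V ≤ finrank K ↥(U * V) + 1 := by
  have hfin : ∀ X : Submodule K L, FiniteDimensional K X → FiniteDimensional K ↥(X * V) := by
    intro X hX
    exact .of_fg ((Module.Finite.iff_fg.1 hX).mul (Module.Finite.iff_fg.1 ‹_›))
  have hle : ∀ X : Submodule K L, X ≤ X * V := by
    intro X x hx
    simpa using Submodule.mul_mem_mul hx hV
  have hrank : ∀ X : Submodule K L, FiniteDimensional K X → finrank K X ≤ finrank K ↥(X * V) := by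
    intro X hX
    have := hfin X hX
    exact Submodule.finrank_mono (hle X)
  let S : Set (Submodule K L) := {X | FiniteDimensional K X ∧ X ≠ ⊥ ∧ X * V ≠ ⊤}
  obtain ⟨κ, ⟨X₀, hX₀, hκ₀⟩, hκ⟩ : ∃ κ : ℕ, (∃ X ∈ S, finrank K ↥(X * V) = finrank K X + κ) ∧
      ∀ X ∈ S, finrank K X + κ ≤ finrank K ↥(X * V) := by
    obtain ⟨X, hX, hmin⟩ := (measure fun X : Submodule K L =>
      finrank K ↥(X * V) - finrank K X).wf.has_min S ⟨U, ‹_›, hU, hUV⟩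
    refine ⟨finrank K ↥(X * V) - finrank K X, ⟨X, hX, ?_⟩, fun Y hY => ?_⟩
    · have := hrank X hX.1
      omega
    · have h1 : ¬ finrank K ↥(Y * V) - finrank K Y < finrank K ↥(X * V) - finrank K X := hmin Y hY
      have := hrank Y hY.1
      omega
  let T : Set (Submodule K L) := {X | X ∈ S ∧ finrank K ↥(X * V) = finrank K X + κ}
  obtain ⟨A, hA, hAmin⟩ : ∃ A ∈ T, ∀ X ∈ T, finrank K A ≤ finrank K X := by
    obtain ⟨X, hX, hmin⟩ := (measure fun X : Submodule K L => finrank K X).wf.has_min T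
      ⟨X₀, hX₀, hκ₀⟩
    exact ⟨X, hX, fun Y hY => not_lt.1 (hmin Y hY)⟩
  have hsup : ∀ X ∈ T, ∀ Y ∈ T, finrank K X = finrank K A → finrank K Y = finrank K A →
      X ⊓ Y ≠ ⊥ → (X ⊔ Y) * V ≠ ⊤ := by
    rintro X ⟨⟨hXf, hX0, hXV⟩, hXκ⟩ Y ⟨⟨hYf, hY0, hYV⟩, hYκ⟩ hXA hYA hne htop
    have hLf : FiniteDimensional K L := by
      have := hfin (X ⊔ Y) inferInstance
      rw [htop] at this
      exact Submodule.topEquiv.finiteDimensional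
    obtain ⟨Z, hZ1, hZ2⟩ := exists_finrank_dual_mul X V
    have hXlt := Submodule.finrank_lt hXV
    have hXpos : 0 < finrank K X := Nat.pos_of_ne_zero fun h => hX0 (Submodule.finrank_eq_zero.1 h)
    have hZS : Z ∈ S := by
      refine ⟨inferInstance, ?_, ?_⟩
      · rintro rfl
        rw [finrank_bot] at hZ1
        omega
      · intro h
        rw [h, finrank_top] at hZ2
        omega
    have hZκ := hκ Z hZS
    have hZA := hAmin Z ⟨hZS, by omega⟩
    have hI : X ⊓ Y ∈ S := by
      refine ⟨inferInstance, hne, fun h => hXV ?_⟩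
      exact top_le_iff.1 (h ▸ mul_le_mul_left inf_le_left V)
    have hIκ := hκ _ hI
    have hIpos : 0 < finrank K ↥(X ⊓ Y) :=
      Nat.pos_of_ne_zero fun h => hne (Submodule.finrank_eq_zero.1 h)
    have hmod := Submodule.finrank_sup_add_finrank_inf_eq (X * V) (Y * V)
    have hinf : (X ⊓ Y) * V ≤ X * V ⊓ (Y * V) :=
      le_inf (mul_le_mul_left inf_le_left V) (mul_le_mul_left inf_le_right V)
    have := Submodule.finrank_mono hinf
    rw [← Submodule.sup_mul, htop, finrank_top] at hmod
    omega
  have hatom : ∀ X ∈ T, ∀ Y ∈ T, finrank K X = finrank K A → finrank K Y = finrank K A →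
      X ⊓ Y ≠ ⊥ → X = Y := by
    intro X hX Y hY hXA hYA hne
    have hsup' := hsup X hX Y hY hXA hYA hne
    obtain ⟨⟨hXf, hX0, hXV⟩, hXκ⟩ := hX
    obtain ⟨⟨hYf, hY0, hYV⟩, hYκ⟩ := hY
    have := hfin X hXf
    have := hfin Y hYf
    have hI : X ⊓ Y ∈ S := by
      refine ⟨inferInstance, hne, fun h => hXV ?_⟩
      exact top_le_iff.1 (h ▸ mul_le_mul_left inf_le_left V)
    have hIκ := hκ _ hI
    have hSκ := hκ (X ⊔ Y) ⟨inferInstance, fun h => hX0 (sup_eq_bot_iff.1 h).1, hsup'⟩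
    have hmod := Submodule.finrank_sup_add_finrank_inf_eq (X * V) (Y * V)
    have hmod' := Submodule.finrank_sup_add_finrank_inf_eq X Y
    have hinf : (X ⊓ Y) * V ≤ X * V ⊓ (Y * V) :=
      le_inf (mul_le_mul_left inf_le_left V) (mul_le_mul_left inf_le_right V)
    have := Submodule.finrank_mono hinf
    rw [← Submodule.sup_mul] at hmod
    have hIA := hAmin (X ⊓ Y) ⟨hI, by omega⟩
    have h1 : X ⊓ Y = X := Submodule.eq_of_le_of_finrank_le inf_le_left (by omega)
    have h2 : X ⊓ Y = Y := Submodule.eq_of_le_of_finrank_le inf_le_right (by omega)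
    exact h1.symm.trans h2
  have hscale : ∀ X ∈ T, ∀ c : L, c ≠ 0 → Submodule.span K {c} * X ∈ T := by
    rintro X ⟨⟨hXf, hX0, hXV⟩, hXκ⟩ c hc
    refine ⟨⟨.of_fg ((Submodule.fg_span_singleton c).mul (Module.Finite.iff_fg.1 hXf)),
      fun h => hX0 ?_, fun h => hXV ?_⟩, ?_⟩
    · rw [← span_singleton_inv_mul_span_singleton_mul hc X, h, Submodule.mul_bot]
    · rw [mul_assoc] at h
      rw [eq_top_iff]
      intro x _
      obtain ⟨z, hz, hzx⟩ := Submodule.mem_span_singleton_mul.1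
        (h.symm ▸ Submodule.mem_top : c * x ∈ Submodule.span K {c} * (X * V))
      rwa [← mul_left_cancel₀ hc hzx]
    · rw [mul_assoc, finrank_span_singleton_mul hc, finrank_span_singleton_mul hc, hXκ]
  obtain ⟨a, haA, ha⟩ := Submodule.exists_mem_ne_zero_of_ne_bot hA.1.2.1
  obtain ⟨H, hH, hHA, hH1⟩ : ∃ H ∈ T, finrank K H = finrank K A ∧ (1 : L) ∈ H :=
    ⟨_, hscale A hA a⁻¹ (inv_ne_zero ha), finrank_span_singleton_mul (inv_ne_zero ha) A,
      Submodule.mem_span_singleton_mul.2 ⟨a, haA, inv_mul_cancel₀ ha⟩⟩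
  have hinv : ∀ x ∈ H, x ≠ 0 → Submodule.span K {x⁻¹} * H = H := by
    intro x hx hx0
    refine hatom _ (hscale H hH _ (inv_ne_zero hx0)) H hH
      ((finrank_span_singleton_mul (inv_ne_zero hx0) H).trans hHA) hHA fun h => ?_
    have : (1 : L) ∈ Submodule.span K {x⁻¹} * H ⊓ H :=
      ⟨Submodule.mem_span_singleton_mul.2 ⟨x, hx, inv_mul_cancel₀ hx0⟩, hH1⟩
    rw [h] at this
    exact one_ne_zero this
  have hHinv : ∀ x ∈ H, x⁻¹ ∈ H := by
    intro x hx
    by_cases hx0 : x = 0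
    · simp [hx0]
    · rw [← hinv x hx hx0]
      exact Submodule.mem_span_singleton_mul.2 ⟨1, hH1, mul_one _⟩
  have hHmul : ∀ x y, x ∈ H → y ∈ H → x * y ∈ H := by
    intro x y hx hy
    by_cases hx0 : x = 0
    · simp [hx0]
    · rw [← hinv x⁻¹ (hHinv x hx) (inv_ne_zero hx0), inv_inv]
      exact Submodule.mem_span_singleton_mul.2 ⟨y, hy, rfl⟩
  let F : IntermediateField K L :=
    (H.toSubalgebra hH1 hHmul).toIntermediateField hHinv
  have hFH : Subalgebra.toSubmodule F.toSubalgebra = H := rfl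
  obtain ⟨⟨hHf, -, hHV⟩, hHκ⟩ := hH
  rcases hF F hHf with h | h
  · have hH' : H = 1 := by
      rw [← hFH, h, IntermediateField.bot_toSubalgebra, Algebra.toSubmodule_bot]
    rw [hH', one_mul, Submodule.one_eq_span, finrank_span_singleton one_ne_zero] at hHκ
    have := hκ U ⟨‹_›, hU, hUV⟩
    omega
  · refine absurd (top_le_iff.1 ?_) hHV
    rw [← hFH, h, IntermediateField.top_toSubalgebra, Algebra.top_toSubmodule]
    exact hle ⊤

/-- The dimension criterion for matchability. -/
theorem exists_basis_forall_le_span_image_ne {K V : Type*} [Field K] [AddCommGroup V] [Module K V]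
    [FiniteDimensional K V] {n : ℕ} (hn : finrank K V = n) (C : Fin n → Submodule K V)
    (hC : ∀ J : Finset (Fin n), J.Nonempty → J.card + finrank K ↥(J.inf C) ≤ n) :
    ∃ b : Basis (Fin n) K V, ∀ i, C i ≤ Submodule.span K (b '' {j | j ≠ i}) := by
  obtain ⟨φ, hφC, hφ⟩ := exists_linearIndependent_mem_of_card_le_finrank
    (fun i => (C i).dualAnnihilator) (by
      intro J
      rcases J.eq_empty_or_nonempty with rfl | hJ
      · simp
      have e : J.sup (fun i => (C i).dualAnnihilator) = (J.inf C).dualAnnihilator := by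
        clear hC
        induction J using Finset.induction_on with
        | empty => simp
        | insert i J hi ih =>
          rcases J.eq_empty_or_nonempty with rfl | hJ
          · simp
          · rw [Finset.sup_insert, Finset.inf_insert, ih hJ]
            exact (Subspace.dualAnnihilator_inf_eq _ _).symm
      rw [e]
      have h1 := Subspace.finrank_add_finrank_dualAnnihilator_eq (J.inf C)
      have h2 := hC J hJ
      omega)
  have hspan : Submodule.span K (Set.range φ) = ⊤ :=
    hφ.span_eq_top_of_card_eq_finrank' (by rw [Subspace.dual_finrank_eq, hn, Fintype.card_fin])
  have hinj : Function.Injective (LinearMap.pi φ) := by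
    rw [← LinearMap.ker_eq_bot, LinearMap.ker_eq_bot']
    intro v hv
    rw [← Module.forall_dual_apply_eq_zero_iff K]
    intro f
    have hf : f ∈ Submodule.span K (Set.range φ) := hspan ▸ Submodule.mem_top
    induction hf using Submodule.span_induction with
    | mem x hx =>
      obtain ⟨i, rfl⟩ := hx
      exact congrFun hv i
    | zero => rfl
    | add x y _ _ hx hy => rw [LinearMap.add_apply, hx, hy, add_zero]
    | smul c x _ hx => rw [LinearMap.smul_apply, hx, smul_zero]
  let b : Basis (Fin n) K V := Basis.ofEquivFun
    (LinearEquiv.ofInjectiveOfFinrankEq (LinearMap.pi φ) hinj (by simp [hn]))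
  refine ⟨b, fun i y hy => ?_⟩
  rw [Basis.mem_span_image]
  intro j hj
  rintro rfl
  apply Finsupp.mem_support_iff.1 (Finset.mem_coe.1 hj)
  exact (Submodule.mem_dualAnnihilator _).1 (hφC j) y hy

theorem isMatchedTo_of_forall_intermediateField {K L : Type*} [Field K] [Field L] [Algebra K L]
    (hF : ∀ F : IntermediateField K L, FiniteDimensional K F → F = ⊥ ∨ F = ⊤)
    (A B : Submodule K L) [FiniteDimensional K A] [FiniteDimensional K B]
    (hAB : finrank K A = finrank K B) (hB : (1 : L) ∉ B) : IsMatchedTo A B := by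
  intro n a ha haA
  have hAn : finrank K A = n := by
    rw [← haA, finrank_span_eq_card ha, Fintype.card_fin]
  have hAtop : A ≠ ⊤ := by
    rintro rfl
    have : FiniteDimensional K L := Submodule.topEquiv.finiteDimensional
    rw [finrank_top] at hAB
    rw [Submodule.eq_top_of_finrank_eq hAB.symm] at hB
    exact hB Submodule.mem_top
  have haA' : ∀ i, a i ∈ A := fun i => haA ▸ Submodule.subset_span ⟨i, rfl⟩
  let C : Fin n → Submodule K B := fun i => A.comap (LinearMap.mulLeft K (a i) ∘ₗ B.subtype)
  have hmemC : ∀ i (y : B), y ∈ C i ↔ a i * y ∈ A := fun _ _ => Iff.rfl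
  obtain ⟨b, hb⟩ := exists_basis_forall_le_span_image_ne (hAB.symm.trans hAn) C (by
    intro J hJ
    let U : Submodule K L := Submodule.span K (a '' J)
    let X : Submodule K L := (J.inf C).map B.subtype
    let V : Submodule K L := Submodule.span K {1} ⊔ X
    have hUdim : finrank K U = J.card := by
      have := finrank_span_eq_card (ha.comp ((↑) : J → Fin n) Subtype.val_injective)
      rw [Set.range_comp, Subtype.range_coe_subtype, Fintype.card_coe] at this
      exact this
    have hXdim : finrank K X = finrank K ↥(J.inf C) := Submodule.finrank_map_subtype_eq _ _
    have hXB : X ≤ B := Submodule.map_subtype_le _ _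
    have hVdim : finrank K V = finrank K X + 1 := by
      have h := Submodule.finrank_sup_add_finrank_inf_eq (Submodule.span K {(1 : L)}) X
      have hdisj : Submodule.span K {(1 : L)} ⊓ X = ⊥ := by
        rw [← disjoint_iff]
        exact ((Submodule.disjoint_span_singleton' one_ne_zero).2 fun h => hB (hXB h)).symm
      rw [hdisj, finrank_bot, finrank_span_singleton one_ne_zero] at h
      exact h.trans (add_comm _ _)
    have hUfin : FiniteDimensional K U :=
      FiniteDimensional.span_of_finite K (J.finite_toSet.image a)
    have hUV : U * V ≤ A := by
      rw [Submodule.mul_sup, sup_le_iff, ← Submodule.one_eq_span, mul_one]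
      have hUA : U ≤ A := by
        rw [Submodule.span_le]
        rintro _ ⟨i, -, rfl⟩
        exact haA' i
      refine ⟨hUA, ?_⟩
      rw [Submodule.mul_le]
      rintro u hu _ ⟨y, hy, rfl⟩
      induction hu using Submodule.span_induction with
      | mem x hx =>
        obtain ⟨i, hi, rfl⟩ := hx
        exact (hmemC i y).1 (Finset.inf_le (f := C) (Finset.mem_coe.1 hi) hy)
      | zero => simp
      | add x z _ _ hx hz => rw [add_mul]; exact A.add_mem hx hz
      | smul c x _ hx => rw [smul_mul_assoc]; exact A.smul_mem c hx
    have hU0 : U ≠ ⊥ := by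
      intro h
      rw [h, finrank_bot] at hUdim
      exact hJ.card_pos.ne hUdim
    have := finrank_add_finrank_le_finrank_mul_add_one hF U V hU0
      (le_sup_left (a := Submodule.span K {(1 : L)}) (Submodule.mem_span_singleton_self 1))
      fun h => hAtop (top_le_iff.1 (h ▸ hUV))
    have := Submodule.finrank_mono hUV
    omega)
  refine ⟨fun i => b i, b.linearIndependent.map' B.subtype B.ker_subtype, ?_, ?_⟩
  · rw [show (fun i => (b i : L)) = B.subtype ∘ b from rfl, Set.range_comp, ← Submodule.map_span,
      b.span_eq, Submodule.map_subtype_top]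
  · intro i x hx hxB
    have hmem : (⟨(a i)⁻¹ * x, hxB⟩ : B) ∈ C i := by
      rw [hmemC, mul_inv_cancel_left₀ (ha.ne_zero i)]
      exact hx
    have := Submodule.mem_map_of_mem (f := B.subtype) (hb i hmem)
    rwa [Submodule.map_span, ← Set.image_comp] at this

theorem exists_not_isMatchedTo {K L : Type*} [Field K] [Field L] [Algebra K L]
    (F : IntermediateField K L) [FiniteDimensional K F] (hbot : F ≠ ⊥) (htop : F ≠ ⊤) :
    ∃ A B : Submodule K L, FiniteDimensional K A ∧ FiniteDimensional K B ∧
      finrank K A = finrank K B ∧ 0 < finrank K A ∧ (1 : L) ∉ B ∧ ¬ IsMatchedTo A B := by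
  obtain ⟨x, hx⟩ : ∃ x, x ∉ F := by
    by_contra! h
    exact htop (eq_top_iff.2 fun y _ => h y)
  let A : Submodule K L := Subalgebra.toSubmodule F.toSubalgebra
  have hA : ∀ y, y ∈ A ↔ y ∈ F := fun _ => Iff.rfl
  have hAfin : FiniteDimensional K A := ‹_›
  have hAF : finrank K A = finrank K F := rfl
  have hApos : 0 < finrank K A := finrank_pos (R := K) (M := F)
  have h1A : Submodule.span K {(1 : L)} ≤ A := by
    simpa using (hA 1).2 F.one_mem
  obtain ⟨C, hC⟩ := exists_isCompl (Submodule.span K {(1 : L)})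
  let V : Submodule K L := C ⊓ A
  have hVA : V ≤ A := inf_le_right
  have h1V : (1 : L) ∉ V := fun h => one_ne_zero
    (Submodule.disjoint_def.1 hC.disjoint 1 (Submodule.mem_span_singleton_self 1) h.1)
  have hVdim : finrank K V + 1 = finrank K A := by
    have h := Submodule.finrank_sup_add_finrank_inf_eq (Submodule.span K {(1 : L)}) V
    have e : Submodule.span K {(1 : L)} ⊔ V = A := by
      rw [← sup_inf_assoc_of_le _ h1A, hC.sup_eq_top, top_inf_eq]
    have e' : Submodule.span K {(1 : L)} ⊓ V = ⊥ :=
      disjoint_iff.1 (hC.disjoint.mono_right inf_le_left)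
    rw [e, e', finrank_bot, finrank_span_singleton one_ne_zero] at h
    omega
  have hx0 : x ≠ 0 := fun h => hx (h ▸ F.zero_mem)
  let B : Submodule K L := V ⊔ Submodule.span K {x}
  have hBdim : finrank K B = finrank K V + 1 := by
    have h := Submodule.finrank_sup_add_finrank_inf_eq V (Submodule.span K {x})
    have e : V ⊓ Submodule.span K {x} = ⊥ :=
      disjoint_iff.1 ((Submodule.disjoint_span_singleton' hx0).2 fun h => hx (hVA h))
    rw [e, finrank_bot, finrank_span_singleton hx0] at h
    exact h
  have h1B : (1 : L) ∉ B := by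
    intro h
    obtain ⟨v, hv, w, hw, hvw⟩ := Submodule.mem_sup.1 h
    obtain ⟨c, rfl⟩ := Submodule.mem_span_singleton.1 hw
    by_cases hc : c = 0
    · rw [hc, zero_smul, add_zero] at hvw
      exact h1V (hvw ▸ hv)
    · have hcx : c • x ∈ A := by
        rw [eq_sub_of_add_eq' hvw]
        exact A.sub_mem ((hA 1).2 F.one_mem) (hVA hv)
      exact hx ((A.smul_mem_iff hc).1 hcx)
  have hV0 : V ≠ ⊥ := by
    intro h
    rw [h, finrank_bot, zero_add, hAF] at hVdim
    exact hbot (IntermediateField.finrank_eq_one_iff.1 hVdim.symm)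
  refine ⟨A, B, hAfin, inferInstance, by omega, hApos, h1B, fun hmatch => ?_⟩
  let a := finBasis K A
  have haA : Submodule.span K (Set.range fun i => (a i : L)) = A := by
    rw [show (fun i => (a i : L)) = A.subtype ∘ a from rfl, Set.range_comp, ← Submodule.map_span,
      a.span_eq, Submodule.map_subtype_top]
  obtain ⟨b, hb, hbB, hab⟩ := hmatch _ (fun i => (a i : L))
    (a.linearIndependent.map' A.subtype A.ker_subtype) haA
  obtain ⟨v, hv, hv0⟩ := Submodule.exists_mem_ne_zero_of_ne_bot hV0
  have hvB : v ∈ B := le_sup_left (a := V) hv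
  have hvspan : ∀ i, v ∈ Submodule.span K (b '' {j | j ≠ i}) := by
    intro i
    have hai : (a i : L) ≠ 0 := fun h => a.ne_zero i (Subtype.ext h)
    have h := hab i (a i * v) (F.mul_mem (a i).2 (hVA hv))
    rw [inv_mul_cancel_left₀ hai] at h
    exact h hvB
  have hvr : v ∈ Submodule.span K (Set.range b) := hbB ▸ hvB
  have hrepr : hb.repr ⟨v, hvr⟩ = 0 := by
    ext i
    obtain ⟨l, hl, hlv⟩ := (Finsupp.mem_span_image_iff_linearCombination K).1 (hvspan i)
    rw [hb.repr_eq (l := l) hlv]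
    by_contra h
    exact hl (Finsupp.mem_support_iff.2 h) rfl
  have := hb.linearCombination_repr ⟨v, hvr⟩
  rw [hrepr, map_zero] at this
  exact hv0 this.symm

/-- A field extension `K ⊊ L` has the linear matching property (every pair of
finite-dimensional subspaces `A`, `B` with `dim A = dim B > 0` and `1 ∉ B` is matched)
if and only if every finite-dimensional intermediate field `F` of `K ⊆ L` equals `K`
or `L`. -/
theorem stmt_16 {K L : Type*} [Field K] [Field L] [Algebra K L]
    (hKL : ∃ x : L, x ∉ Set.range (algebraMap K L)) :
    (∀ A B : Submodule K L, FiniteDimensional K A → FiniteDimensional K B →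
        Module.finrank K ↥A = Module.finrank K ↥B → 0 < Module.finrank K ↥A →
        (1 : L) ∉ B → IsMatchedTo A B) ↔
      ∀ F : IntermediateField K L, FiniteDimensional K F → F = ⊥ ∨ F = ⊤ := by
  constructor
  · intro h F hF
    by_contra! hne
    obtain ⟨A, B, hA, hB, hAB, hpos, h1, hnot⟩ := exists_not_isMatchedTo F hne.1 hne.2
    exact hnot (h A B hA hB hAB hpos h1)
  · intro h A B hA hB hAB _ h1
    exact isMatchedTo_of_forall_intermediateField h A B hAB h1
end
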